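/- Let n ≥ 2, 0 < p ≤ q < ∞, α > 0, and let μ be a positive Borel measure on ℝ^{n+1}_+. Then the following are equivalent: (i) there is C > 0 with μ(Q_w) ≤ C·s^{nq/p + αq} for every w = (y,s) ∈ ℝ^{n+1}_+; (ii) B_α^{q,p} is continuously embedded into L^q(ℝ^{n+1}_+, dμ), i.e. there is C' > 0 such that ∫_{ℝ^{n+1}_+} |f(z)|^q dμ(z) ≤ C' ‖f‖_{B_α^{q,p}}^q for every harmonic f on ℝ^{n+1}_+ with ‖f‖_{B_α^{q,p}} < ∞. -/

import Mathlib

open MeasureTheory Real Set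
open scoped ENNReal

noncomputable section

abbrev Euc (N : ℕ) : Type := EuclideanSpace ℝ (Fin N)

/-- The point `(x, t) ∈ ℝ^{n+1}`. -/
def pt {n : ℕ} (x : Euc n) (t : ℝ) : Euc (n + 1) :=
  (EuclideanSpace.equiv (Fin (n + 1)) ℝ).symm (Fin.snoc (fun i => x i) t)

/-- horizontal part of a point of ℝ^{n+1} -/
def xp {n : ℕ} (z : Euc (n + 1)) : Euc n :=
  (EuclideanSpace.equiv (Fin n) ℝ).symm (fun i => z i.castSucc)

/-- vertical part of a point of ℝ^{n+1} -/
def tp {n : ℕ} (z : Euc (n + 1)) : ℝ := z (Fin.last n)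

/-- The upper half space ℝ^{n+1}_+. -/
def upperHS (n : ℕ) : Set (Euc (n + 1)) := {z | 0 < tp z}

/-- |z - w̄| where z = (x,t), w̄ = (y, -s): Euclidean distance -/
def dB {n : ℕ} (x : Euc n) (t : ℝ) (y : Euc n) (s : ℝ) : ℝ :=
  dist (pt x t) (pt y (-s))

/-- the measure t^λ dx dt on ℝ^n × (0,∞), identified with ℝ^{n+1}_+ -/
def mLam (n : ℕ) (l : ℝ) : Measure (Euc n × ℝ) :=
  ((volume : Measure (Euc n)).prod ((volume : Measure ℝ).restrict (Ioi 0))).withDensity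
    (fun zt => ENNReal.ofReal (zt.2 ^ l))

/-- second derivative of `f` at `z` along direction `v` -/
def d2 {V : Type*} [NormedAddCommGroup V] [NormedSpace ℝ V] (f : V → ℝ) (z v : V) : ℝ :=
  iteratedFDeriv ℝ 2 f z ![v, v]

/-- `f` is harmonic on a subset of ℝ^N : twice continuously differentiable with
vanishing Laplacian. -/
def HarmonicOnE {N : ℕ} (f : Euc N → ℝ) (s : Set (Euc N)) : Prop :=
  ContDiffOn ℝ 2 f s ∧ ∀ z ∈ s, ∑ i, d2 f z (EuclideanSpace.single i 1) = 0

/-- `f` is harmonic on (ℝ^{n+1}_+)^m, viewed as an open subset of ℝ^{m(n+1)}. -/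
def HarmonicOnM {n m : ℕ} (f : (Fin m → Euc (n + 1)) → ℝ) : Prop :=
  ContDiffOn ℝ 2 f {z | ∀ j, z j ∈ upperHS n} ∧
  ∀ z ∈ {z : Fin m → Euc (n + 1) | ∀ j, z j ∈ upperHS n},
    ∑ j, ∑ i, d2 f z (Function.update (0 : Fin m → Euc (n + 1)) j (EuclideanSpace.single i 1)) = 0

/-- `f` is harmonic in each variable separately on (ℝ^{n+1}_+)^m -/
def HarmonicSep {n m : ℕ} (f : (Fin m → Euc (n + 1)) → ℝ) : Prop :=
  ∀ (j : Fin m) (z : Fin m → Euc (n + 1)), (∀ k, z k ∈ upperHS n) →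
    HarmonicOnE (fun w => f (Function.update z j w)) (upperHS n)

/-- the closed cube centered at (y,s) with side length s -/
def Qcube {n : ℕ} (y : Euc n) (s : ℝ) : Set (Euc (n + 1)) :=
  {z | (∀ i : Fin n, |z (Fin.castSucc i) - y i| ≤ s / 2) ∧ |tp z - s| ≤ s / 2}

/-- the A^p_λ (quasi)-norm, raised to the power p -/
def normAp (n : ℕ) (f : Euc (n + 1) → ℝ) (p l : ℝ) : ℝ≥0∞ :=
  ∫⁻ zt : Euc n × ℝ, ENNReal.ofReal (|f (pt zt.1 zt.2)| ^ p) ∂(mLam n l)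

/-- membership in the harmonic Bergman space A^p_λ -/
def memAp (n : ℕ) (f : Euc (n + 1) → ℝ) (p l : ℝ) : Prop :=
  HarmonicOnE f (upperHS n) ∧ normAp n f p l < ⊤


/-- M_p(f,t) = (∫_{ℝ^n} |f(x,t)|^p dx)^{1/p} -/
def Mp (n : ℕ) (f : Euc (n + 1) → ℝ) (p t : ℝ) : ℝ≥0∞ :=
  (∫⁻ x : Euc n, ENNReal.ofReal (|f (pt x t)| ^ p)) ^ (1 / p)

/-- the mixed norm ‖f‖_{B^{p,q}_α} = (∫_0^∞ M_q(f,t)^p t^{αp-1} dt)^{1/p} -/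
def normB (n : ℕ) (f : Euc (n + 1) → ℝ) (p q α : ℝ) : ℝ≥0∞ :=
  (∫⁻ t in Ioi (0 : ℝ), (Mp n f q t) ^ p * ENNReal.ofReal (t ^ (α * p - 1))) ^ (1 / p)

lemma hasDerivAt_sq_max_zero (u : ℝ) : HasDerivAt (fun v : ℝ => (max v 0) ^ 2) (2 * max u 0) u := by
  rcases lt_trichotomy u 0 with h | h | h
  · rw [max_eq_right h.le, mul_zero]
    refine (hasDerivAt_const u (0 : ℝ)).congr_of_eventuallyEq ?_
    filter_upwards [Iio_mem_nhds h] with v hv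
    simp [max_eq_right (le_of_lt (mem_Iio.1 hv))]
  · subst h
    rw [max_self, mul_zero, hasDerivAt_iff_isLittleO_nhds_zero]
    simp only [zero_add, max_self, smul_zero, sub_zero, ne_eq, OfNat.ofNat_ne_zero,
      not_false_eq_true, zero_pow]
    refine Asymptotics.IsBigO.trans_isLittleO (g := fun v : ℝ => v ^ 2) ?_ ?_
    · refine Asymptotics.IsBigO.of_bound 1 (Filter.Eventually.of_forall fun v => ?_)
      rw [one_mul, norm_pow, norm_pow]
      gcongr
      rcases le_total v 0 with hv | hv
      · simp [max_eq_right hv]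
      · simp [max_eq_left hv]
    · exact Asymptotics.isLittleO_pow_id one_lt_two
  · rw [max_eq_left h.le]
    have := hasDerivAt_pow 2 u
    simp only [Nat.cast_ofNat, Nat.add_one_sub_one, pow_one] at this
    refine this.congr_of_eventuallyEq ?_
    filter_upwards [Ioi_mem_nhds h] with v hv
    simp [max_eq_left (le_of_lt (mem_Ioi.1 hv))]

/-- A radial averaging kernel supported in the closed unit ball. -/
def tent {N : ℕ} (y : Euc N) : ℝ := max (1 - ‖y‖ ^ 2) 0

lemma continuous_tent {N : ℕ} : Continuous (tent (N := N)) := by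
  unfold tent; fun_prop

lemma tent_nonneg {N : ℕ} (y : Euc N) : 0 ≤ tent y := le_max_right _ _

lemma tent_le_one {N : ℕ} (y : Euc N) : tent y ≤ 1 := by
  unfold tent
  exact max_le (by nlinarith [sq_nonneg ‖y‖]) zero_le_one

lemma tent_eq_zero {N : ℕ} {y : Euc N} (hy : 1 ≤ ‖y‖) : tent y = 0 := by
  unfold tent
  exact max_eq_right (by nlinarith)

lemma hasCompactSupport_tent {N : ℕ} : HasCompactSupport (tent (N := N)) := by
  refine HasCompactSupport.of_support_subset_isCompact (isCompact_closedBall (0 : Euc N) 1) ?_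
  intro y hy
  by_contra h
  simp only [Metric.mem_closedBall, dist_zero_right, not_le] at h
  exact hy (tent_eq_zero h.le)

lemma integral_tent_pos {N : ℕ} : 0 < ∫ y : Euc N, tent y := by
  refine continuous_tent.integral_pos_of_hasCompactSupport_nonneg_nonzero
    hasCompactSupport_tent tent_nonneg (x := 0) ?_
  simp [tent]

lemma hasFDerivAt_tent_sq {N : ℕ} (y : Euc N) :
    HasFDerivAt (fun y : Euc N => tent y ^ 2) ((-4 * tent y) • innerSL ℝ y) y := by
  have h1 : HasFDerivAt (fun y : Euc N => 1 - ‖y‖ ^ 2) (-(2 • innerSL ℝ y)) y :=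
    ((hasStrictFDerivAt_norm_sq y).hasFDerivAt).const_sub 1
  have h2 := (hasDerivAt_sq_max_zero (1 - ‖y‖ ^ 2)).comp_hasFDerivAt y h1
  refine h2.congr_fderiv ?_
  ext v
  simp [tent]
  ring

lemma fderiv_tent_sq {N : ℕ} (y v : Euc N) :
    fderiv ℝ (fun y : Euc N => tent y ^ 2) y v = -4 * tent y * inner ℝ y v := by
  rw [(hasFDerivAt_tent_sq y).fderiv]; simp

lemma hasCompactSupport_tent_sq {N : ℕ} : HasCompactSupport (fun y : Euc N => tent y ^ 2) := by
  simp only [sq]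
  exact hasCompactSupport_tent.mul_right

lemma fderiv_eq_sum_coord {N : ℕ} (L : Euc N →L[ℝ] ℝ) (y : Euc N) :
    L y = ∑ i, y i * L (EuclideanSpace.single i 1) := by
  conv_lhs => rw [← (EuclideanSpace.basisFun (Fin N) ℝ).sum_repr y]
  simp [map_sum]

set_option maxHeartbeats 1000000 in
/-- The radial derivative of a harmonic function averages to zero against the kernel. -/
lemma integral_fderiv_mul_tent_eq_zero {N : ℕ} {u : Euc N → ℝ} (hu : ContDiff ℝ 2 u) (z : Euc N)
    {r : ℝ}
    (hΔ : ∀ w ∈ Metric.ball z r, ∑ i, d2 u w (EuclideanSpace.single i 1) = 0)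
    {ρ : ℝ} (hρ : ρ ∈ Icc 0 r) :
    ∫ y, fderiv ℝ u (z + ρ • y) y * tent y = 0 := by
  have hu' : ContDiff ℝ 1 (fderiv ℝ u) := hu.fderiv_right (by norm_num)
  let e : Fin N → Euc N := fun i => EuclideanSpace.single i 1
  have hcd : ∀ i, ContDiff ℝ 1 (fun y : Euc N => fderiv ℝ u (z + ρ • y) (e i)) := fun i =>
    ContDiff.clm_apply (f := fun y => fderiv ℝ u (z + ρ • y))
      (hu'.comp (g := fderiv ℝ u) (by fun_prop)) contDiff_const
  have hder : ∀ i y, fderiv ℝ (fun y : Euc N => fderiv ℝ u (z + ρ • y) (e i)) y (e i)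
      = ρ * d2 u (z + ρ • y) (e i) := by
    intro i y
    have h1 : HasFDerivAt (fun y : Euc N => z + ρ • y) (ρ • ContinuousLinearMap.id ℝ (Euc N)) y :=
      ((hasFDerivAt_id y).const_smul ρ).const_add z
    have h2 : HasFDerivAt (fderiv ℝ u) (fderiv ℝ (fderiv ℝ u) (z + ρ • y)) (z + ρ • y) :=
      (hu'.differentiable (by norm_num) _).hasFDerivAt
    have h3 := (h2.comp y h1).clm_apply (hasFDerivAt_const (e i) y)
    have h3' : HasFDerivAt (fun y : Euc N => fderiv ℝ u (z + ρ • y) (e i)) _ y := h3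
    rw [h3'.fderiv, d2, iteratedFDeriv_two_apply]
    simp
  have hdc : ∀ i, Continuous (fun y : Euc N =>
      fderiv ℝ (fun y : Euc N => fderiv ℝ u (z + ρ • y) (e i)) y (e i)) := fun i =>
    ((hcd i).continuous_fderiv (by norm_num)).clm_apply continuous_const
  have hsqd : Differentiable ℝ (fun y : Euc N => tent y ^ 2) := fun y =>
    (hasFDerivAt_tent_sq y).differentiableAt
  have hibp : ∀ i, ∫ y, fderiv ℝ u (z + ρ • y) (e i) * (y i * tent y)
      = 4⁻¹ * ∫ y, ρ * d2 u (z + ρ • y) (e i) * tent y ^ 2 := by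
    intro i
    have key := integral_mul_fderiv_eq_neg_fderiv_mul_of_integrable (μ := (volume : Measure (Euc N)))
      (f := fun y => fderiv ℝ u (z + ρ • y) (e i)) (g := fun y : Euc N => tent y ^ 2) (v := e i)
      ?_ ?_ ?_ (fun x _ => (hcd i).differentiable (by norm_num) x) (fun x _ => hsqd x)
    · simp only [hder, fderiv_tent_sq] at key
      have h4 : ∀ y : Euc N, fderiv ℝ u (z + ρ • y) (e i) * (-4 * tent y * inner ℝ y (e i))
          = -4 * (fderiv ℝ u (z + ρ • y) (e i) * (y i * tent y)) := by
        intro y; simp [e, EuclideanSpace.inner_single_right]; ring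
      simp only [h4] at key
      rw [integral_const_mul] at key
      linarith
    · exact ((hdc i).mul (continuous_tent.pow 2)).integrable_of_hasCompactSupport
        hasCompactSupport_tent_sq.mul_left
    · simp only [fderiv_tent_sq]
      refine Continuous.integrable_of_hasCompactSupport ?_ ?_
      · exact (hcd i).continuous.mul (by have := continuous_tent (N := N); fun_prop)
      · refine HasCompactSupport.mul_left (HasCompactSupport.mul_right ?_)
        exact hasCompactSupport_tent.mul_left
    · exact ((hcd i).continuous.mul (continuous_tent.pow 2)).integrable_of_hasCompactSupport
        hasCompactSupport_tent_sq.mul_left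
  have h1 : ∀ y : Euc N, fderiv ℝ u (z + ρ • y) y * tent y
      = ∑ i, fderiv ℝ u (z + ρ • y) (e i) * (y i * tent y) := by
    intro y
    rw [fderiv_eq_sum_coord (fderiv ℝ u (z + ρ • y)) y, Finset.sum_mul]
    exact Finset.sum_congr rfl fun i _ => by ring
  simp only [h1]
  have hcd2 : ∀ i, Continuous (fun y : Euc N => ρ * d2 u (z + ρ • y) (e i)) := fun i => by
    simpa only [hder] using hdc i
  rw [integral_finsetSum]
  · simp only [hibp]
    rw [← Finset.mul_sum, ← integral_finsetSum]
    · rw [mul_eq_zero]; right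
      refine integral_eq_zero_of_ae (Filter.Eventually.of_forall fun y => ?_)
      simp only [← Finset.sum_mul, ← Finset.mul_sum, Pi.zero_apply]
      rcases lt_or_ge ‖y‖ 1 with hy | hy
      · rcases eq_or_lt_of_le hρ.1 with h0 | h0
        · simp [← h0]
        · rw [hΔ (z + ρ • y)]
          · simp
          · simp only [Metric.mem_ball, dist_self_add_left, norm_smul, Real.norm_eq_abs, abs_of_pos h0]
            nlinarith [hρ.2, norm_nonneg y]
      · simp [tent_eq_zero hy]
    · intro i _
      exact ((hcd2 i).mul (continuous_tent.pow 2)).integrable_of_hasCompactSupport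
        hasCompactSupport_tent_sq.mul_left
  · intro i _
    refine Continuous.integrable_of_hasCompactSupport ?_ ?_
    · exact (hcd i).continuous.mul (by have := continuous_tent (N := N); fun_prop)
    · exact (hasCompactSupport_tent.mul_left).mul_left

/-- Weighted mean value property. -/
lemma mul_integral_tent_eq {N : ℕ} {u : Euc N → ℝ} (hu : ContDiff ℝ 2 u) (z : Euc N)
    {r : ℝ} (hr : 0 ≤ r)
    (hΔ : ∀ w ∈ Metric.ball z r, ∑ i, d2 u w (EuclideanSpace.single i 1) = 0) :
    ∫ y, u (z + r • y) * tent y = u z * ∫ y : Euc N, tent y := by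
  have hu' : Continuous (fderiv ℝ u) := hu.continuous_fderiv (by norm_num)
  have hd : ∀ ρ : ℝ, HasDerivAt (fun ρ : ℝ => ∫ y, u (z + ρ • y) * tent y)
      (∫ y, fderiv ℝ u (z + ρ • y) y * tent y) ρ := by
    intro ρ
    have hc : Continuous fun x : ℝ × Euc N => fderiv ℝ u (z + x.1 • x.2) x.2 :=
      (hu'.comp (by fun_prop)).clm_apply continuous_snd
    obtain ⟨C, hC⟩ := ((isCompact_closedBall ρ 1).prod
      (isCompact_closedBall (0 : Euc N) 1)).exists_bound_of_continuousOn hc.continuousOn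
    have := hasDerivAt_integral_of_dominated_loc_of_deriv_le (μ := (volume : Measure (Euc N)))
      (F := fun (ρ : ℝ) y => u (z + ρ • y) * tent y)
      (F' := fun (ρ : ℝ) y => fderiv ℝ u (z + ρ • y) y * tent y) (x₀ := ρ)
      (s := Metric.ball ρ 1) (bound := fun y => C * tent y)
      (Metric.ball_mem_nhds ρ one_pos) ?_ ?_ ?_ ?_ ?_ ?_
    · exact this.2
    · refine Filter.Eventually.of_forall fun x => Continuous.aestronglyMeasurable ?_
      exact (hu.continuous.comp (by fun_prop)).mul continuous_tent
    · refine Continuous.integrable_of_hasCompactSupport ?_ hasCompactSupport_tent.mul_left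
      exact (hu.continuous.comp (by fun_prop)).mul continuous_tent
    · refine Continuous.aestronglyMeasurable ?_
      exact ((hu'.comp (by fun_prop)).clm_apply continuous_id).mul continuous_tent
    · refine Filter.Eventually.of_forall fun y x hx => ?_
      rcases lt_or_ge ‖y‖ 1 with hy | hy
      · rw [norm_mul, Real.norm_of_nonneg (tent_nonneg y)]
        refine mul_le_mul_of_nonneg_right ?_ (tent_nonneg y)
        exact hC (x, y) ⟨Metric.ball_subset_closedBall hx, by simpa using hy.le⟩
      · simp [tent_eq_zero hy]
    · exact (continuous_tent.integrable_of_hasCompactSupport hasCompactSupport_tent).const_mul C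
    · refine Filter.Eventually.of_forall fun y x _ => ?_
      have h1 : HasDerivAt (fun ρ : ℝ => z + ρ • y) y x := by
        simpa using ((hasDerivAt_id x).smul_const y).const_add z
      have h2 := ((hu.differentiable (by norm_num) (z + x • y)).hasFDerivAt).comp_hasDerivAt x h1
      exact h2.mul_const _
  have := constant_of_has_deriv_right_zero (f := fun ρ : ℝ => ∫ y, u (z + ρ • y) * tent y)
    (a := 0) (b := r) (fun x _ => (hd x).continuousAt.continuousWithinAt)
    (fun x hx => by
      have h := (hd x).hasDerivWithinAt (s := Ici x)
      rwa [integral_fderiv_mul_tent_eq_zero hu z hΔ ⟨hx.1, hx.2.le⟩] at h) r ⟨hr, le_rfl⟩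
  simp only [zero_smul, add_zero] at this
  rw [this, integral_const_mul]

/-- A harmonic function is dominated by its mean absolute value over a ball. -/
lemma abs_le_integral_closedBall (N : ℕ) : ∃ K : ℝ, 0 < K ∧ ∀ (f : Euc N → ℝ) (U : Set (Euc N)),
    IsOpen U → HarmonicOnE f U → ∀ (z : Euc N) (r : ℝ), 0 < r → Metric.closedBall z r ⊆ U →
    |f z| ≤ K * (r ^ N)⁻¹ * ∫ w in Metric.closedBall z r, |f w| := by
  have hT := integral_tent_pos (N := N)
  set T := ∫ y : Euc N, tent y with hTdef
  refine ⟨T⁻¹ * 2 ^ N, by positivity, fun f U hU hf z r hr hzU => ?_⟩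
  let χ : ContDiffBump z := ⟨r / 2, r, by positivity, by linarith⟩
  let u : Euc N → ℝ := fun w => χ w * f w
  have hu : ContDiff ℝ 2 u := by
    rw [contDiff_iff_contDiffAt]
    intro w
    by_cases hw : w ∈ U
    · exact χ.contDiffAt.mul (hf.1.contDiffAt (hU.mem_nhds hw))
    · have hw' : w ∉ tsupport χ := by
        rw [χ.tsupport_eq]; exact fun h => hw (hzU h)
      have h0 : u =ᶠ[nhds w] fun _ => 0 := by
        filter_upwards [notMem_tsupport_iff_eventuallyEq.1 hw'] with v hv
        simp only [u, hv, Pi.zero_apply, zero_mul]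
      exact contDiffAt_const.congr_of_eventuallyEq h0
  have hΔ : ∀ w ∈ Metric.ball z (r / 2), ∑ i, d2 u w (EuclideanSpace.single i 1) = 0 := by
    intro w hw
    have hwU : w ∈ U := hzU (Metric.ball_subset_closedBall
      (Metric.ball_subset_ball (by linarith) hw))
    have h1 : u =ᶠ[nhds w] f := by
      filter_upwards [Metric.isOpen_ball.mem_nhds hw] with v hv
      simp only [u]
      rw [χ.one_of_mem_closedBall (Metric.ball_subset_closedBall hv), one_mul]
    have h2 := (h1.iteratedFDeriv (𝕜 := ℝ) 2).eq_of_nhds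
    rw [← hf.2 w hwU]
    refine Finset.sum_congr rfl fun i _ => ?_
    simp only [d2, h2]
  have hmv := mul_integral_tent_eq hu z (by positivity) hΔ
  have huz : u z = f z := by
    simp only [u]
    rw [χ.one_of_mem_closedBall (Metric.mem_closedBall_self (by positivity)), one_mul]
  rw [huz] at hmv
  let v : Euc N → ℝ := (Metric.closedBall z r).indicator fun w => |f w|
  have hv : Integrable v := by
    rw [integrable_indicator_iff Metric.isClosed_closedBall.measurableSet]
    exact ((hf.1.continuousOn.mono hzU).abs).integrableOn_compact (isCompact_closedBall z r)
  have hr2 : r / 2 ≠ 0 := by positivity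
  have hv2 : Integrable fun y => v (z + (r / 2) • y) := (hv.comp_add_left z).comp_smul hr2
  have hval : ∫ y, v (z + (r / 2) • y) = ((r / 2) ^ N)⁻¹ * ∫ w in Metric.closedBall z r, |f w| := by
    rw [Measure.integral_comp_smul volume (fun x => v (z + x)) (r / 2), integral_add_left_eq_self,
      integral_indicator Metric.isClosed_closedBall.measurableSet]
    simp [abs_of_pos (half_pos hr)]
  have hle : |f z * T| ≤ ∫ y, v (z + (r / 2) • y) := by
    rw [← hmv, ← Real.norm_eq_abs]
    refine norm_integral_le_of_norm_le hv2 (Filter.Eventually.of_forall fun y => ?_)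
    have hv0 : ∀ w, 0 ≤ v w := fun w => indicator_nonneg (fun _ _ => abs_nonneg _) w
    rcases lt_or_ge ‖y‖ 1 with hy | hy
    · have hmem : z + (r / 2) • y ∈ Metric.closedBall z r := by
        simp only [Metric.mem_closedBall, dist_self_add_left, norm_smul, Real.norm_eq_abs]
        rw [abs_of_pos (by positivity)]
        nlinarith [norm_nonneg y]
      simp only [v, indicator_of_mem hmem, u]
      rw [norm_mul, norm_mul, Real.norm_of_nonneg (tent_nonneg y), Real.norm_eq_abs (f _),
        Real.norm_of_nonneg χ.nonneg]
      calc _ ≤ 1 * |f (z + (r / 2) • y)| * 1 := by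
            gcongr
            · exact tent_nonneg y
            · exact χ.le_one
            · exact tent_le_one y
        _ = _ := by ring
    · rw [tent_eq_zero hy]; simpa using hv0 _
  rw [hval, abs_mul, abs_of_pos hT, ← le_div_iff₀ hT] at hle
  refine hle.trans (le_of_eq ?_)
  rw [div_pow]
  field_simp

/-- Power of a harmonic function: sub-mean value property for exponents at least one. -/
lemma abs_rpow_le_integral_of_one_le (N : ℕ) {p : ℝ} (hp : 1 ≤ p) : ∃ K : ℝ, 0 < K ∧
    ∀ (f : Euc N → ℝ) (U : Set (Euc N)), IsOpen U → HarmonicOnE f U → ∀ (z : Euc N) (r : ℝ),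
    0 < r → Metric.closedBall z r ⊆ U →
    |f z| ^ p ≤ K * (r ^ N)⁻¹ * ∫ w in Metric.closedBall z r, |f w| ^ p := by
  obtain ⟨K, hK, hK'⟩ := abs_le_integral_closedBall N
  set V := volume.real (Metric.closedBall (0 : Euc N) 1) with hV
  have hVpos : 0 < V := by
    refine ENNReal.toReal_pos ?_ measure_closedBall_lt_top.ne
    exact (Metric.measure_closedBall_pos volume _ one_pos).ne'
  refine ⟨2 * K * (2 * K * V) ^ (p - 1), by positivity, fun f U hU hf z r hr hzU => ?_⟩
  have hcont : ContinuousOn (fun w => |f w|) (Metric.closedBall z r) :=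
    (hf.1.continuousOn.mono hzU).abs
  have hcp : ContinuousOn (fun w => |f w| ^ p) (Metric.closedBall z r) :=
    hcont.rpow_const fun _ _ => Or.inr (by linarith)
  set J := ∫ w in Metric.closedBall z r, |f w| ^ p with hJ
  have hJ0 : 0 ≤ J := integral_nonneg fun w => by positivity
  rcases (abs_nonneg (f z)).eq_or_lt with h0 | h0
  · rw [← h0, Real.zero_rpow (by linarith)]; positivity
  set a := |f z| with ha
  set δ := a / (2 * K * V) with hδ
  have hδ0 : 0 < δ := by positivity
  have hpt : ∀ x : ℝ, 0 ≤ x → x ≤ δ + δ ^ (1 - p) * x ^ p := by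
    intro x hx
    rcases le_or_gt x δ with h | h
    · have : 0 ≤ δ ^ (1 - p) * x ^ p := by positivity
      linarith
    · have hx0 : 0 < x := hδ0.trans h
      have : x = x ^ (1 - p) * x ^ p := by rw [← Real.rpow_add hx0]; simp
      have h2 : x ^ (1 - p) ≤ δ ^ (1 - p) := Real.rpow_le_rpow_of_nonpos hδ0 h.le (by linarith)
      have h3 : x ^ (1 - p) * x ^ p ≤ δ ^ (1 - p) * x ^ p := by gcongr
      linarith
  have hvol : volume.real (Metric.closedBall z r) = r ^ N * V := by
    rw [measureReal_def, Measure.addHaar_closedBall' _ _ hr.le, ENNReal.toReal_mul,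
      ENNReal.toReal_ofReal (by positivity), hV, measureReal_def]
    simp
  have hint : ∫ w in Metric.closedBall z r, |f w| ≤ δ * (r ^ N * V) + δ ^ (1 - p) * J := by
    have h1 : IntegrableOn (fun w => |f w|) (Metric.closedBall z r) :=
      hcont.integrableOn_compact (isCompact_closedBall z r)
    have h2 : IntegrableOn (fun w => |f w| ^ p) (Metric.closedBall z r) :=
      hcp.integrableOn_compact (isCompact_closedBall z r)
    have h3 : IntegrableOn (fun _ : Euc N => δ) (Metric.closedBall z r) :=
      continuousOn_const.integrableOn_compact (isCompact_closedBall z r)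
    calc ∫ w in Metric.closedBall z r, |f w|
        ≤ ∫ w in Metric.closedBall z r, (δ + δ ^ (1 - p) * |f w| ^ p) :=
          integral_mono h1 (h3.add (h2.const_mul _)) fun w => hpt _ (abs_nonneg _)
      _ = _ := by
          rw [integral_add h3 (h2.const_mul _), integral_const_mul, setIntegral_const, hvol, smul_eq_mul,
            mul_comm δ]
  have h1 := hK' f U hU hf z r hr hzU
  have h2 : a ≤ K * (r ^ N)⁻¹ * (δ * (r ^ N * V) + δ ^ (1 - p) * J) :=
    h1.trans (by gcongr)
  have h3 : K * (r ^ N)⁻¹ * (δ * (r ^ N * V) + δ ^ (1 - p) * J)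
      = a / 2 + K * (r ^ N)⁻¹ * δ ^ (1 - p) * J := by
    rw [hδ]; field_simp
  have h4 : a ≤ 2 * (K * (r ^ N)⁻¹ * δ ^ (1 - p) * J) := by linarith
  have h5 : δ ^ (1 - p) * a ^ (p - 1) = (2 * K * V) ^ (p - 1) := by
    rw [hδ, Real.div_rpow h0.le (by positivity), show 1 - p = -(p - 1) by ring, Real.rpow_neg h0.le,
      Real.rpow_neg (by positivity)]
    field_simp
  calc a ^ p = a * a ^ (p - 1) := by
        rw [← Real.rpow_one_add' h0.le (by linarith)]; congr 1; ring
    _ ≤ 2 * (K * (r ^ N)⁻¹ * δ ^ (1 - p) * J) * a ^ (p - 1) := by gcongr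
    _ = 2 * K * (r ^ N)⁻¹ * J * (δ ^ (1 - p) * a ^ (p - 1)) := by ring
    _ = _ := by rw [h5]; ring

/-- Power of a harmonic function: sub-mean value property for exponents below one. -/
lemma abs_rpow_le_integral_of_lt_one (N : ℕ) {p : ℝ} (hp : 0 < p) (hp1 : p < 1) : ∃ K : ℝ, 0 < K ∧
    ∀ (f : Euc N → ℝ) (U : Set (Euc N)), IsOpen U → HarmonicOnE f U → ∀ (z : Euc N) (r : ℝ),
    0 < r → Metric.closedBall z r ⊆ U →
    |f z| ^ p ≤ K * (r ^ N)⁻¹ * ∫ w in Metric.closedBall z r, |f w| ^ p := by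
  obtain ⟨K, hK, hK'⟩ := abs_le_integral_closedBall N
  set B : ℝ := ((2 : ℝ) ^ N) ^ (1 / p) with hB
  have hB0 : 0 < B := by positivity
  refine ⟨2 ^ N * K * B ^ (1 - p), by positivity, fun f U hU hf z r hr hzU => ?_⟩
  have hcont : ContinuousOn (fun w => |f w|) (Metric.closedBall z r) :=
    (hf.1.continuousOn.mono hzU).abs
  have hcp : ContinuousOn (fun w => |f w| ^ p) (Metric.closedBall z r) :=
    hcont.rpow_const fun _ _ => Or.inr hp.le
  set J := ∫ w in Metric.closedBall z r, |f w| ^ p with hJ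
  have hJ0 : 0 ≤ J := integral_nonneg fun w => by positivity
  have hh : ContinuousOn (fun w => |f w| ^ p * (r - dist w z) ^ N) (Metric.closedBall z r) :=
    hcp.mul (by fun_prop)
  obtain ⟨w₀, hw₀, hmax⟩ := (isCompact_closedBall z r).exists_isMaxOn
    ⟨z, Metric.mem_closedBall_self hr.le⟩ hh
  rw [isMaxOn_iff] at hmax
  have hz := hmax z (Metric.mem_closedBall_self hr.le)
  simp only [dist_self, sub_zero] at hz
  suffices hmain : |f w₀| ^ p * (r - dist w₀ z) ^ N ≤ 2 ^ N * K * B ^ (1 - p) * J by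
    rw [mul_right_comm, ← div_eq_mul_inv, le_div_iff₀ (by positivity)]
    exact hz.trans hmain
  have hd : 0 ≤ r - dist w₀ z := by simpa using hw₀
  rcases (abs_nonneg (f w₀)).eq_or_lt with h0 | h0
  · rw [← h0, Real.zero_rpow hp.ne', zero_mul]; positivity
  rcases hd.eq_or_lt with hd0 | hd0
  · have : |f z| ^ p = 0 := by
      by_contra hne
      have hpos : 0 < |f z| ^ p := lt_of_le_of_ne (by positivity) (Ne.symm hne)
      rcases Nat.eq_zero_or_pos N with hN | hN
      · subst hN
        have : w₀ = z := Subsingleton.elim _ _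
        rw [this] at hd0
        simp at hd0
        exact hr.ne hd0
      · rw [← hd0, zero_pow hN.ne', mul_zero] at hz
        have : 0 < |f z| ^ p * r ^ N := by positivity
        linarith
    rcases Nat.eq_zero_or_pos N with hN | hN
    · subst hN
      have : w₀ = z := Subsingleton.elim _ _
      rw [this] at hd0
      simp at hd0
      exact absurd hd0 hr.ne
    · rw [← hd0, zero_pow hN.ne', mul_zero]; positivity
  set a := |f w₀| with ha
  set ρ := (r - dist w₀ z) / 2 with hρ
  have hρ0 : 0 < ρ := by positivity
  have hsub : Metric.closedBall w₀ ρ ⊆ Metric.closedBall z r := by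
    refine Metric.closedBall_subset_closedBall' ?_
    rw [hρ]; linarith
  have hbd : ∀ w ∈ Metric.closedBall w₀ ρ, |f w| ≤ B * a := by
    intro w hw
    have h1 := hmax w (hsub hw)
    have h2 : ρ ≤ r - dist w z := by
      have := dist_triangle w w₀ z
      have hw' : dist w w₀ ≤ ρ := hw
      rw [hρ] at hw' ⊢; linarith
    have h3 : |f w| ^ p * ρ ^ N ≤ a ^ p * (2 * ρ) ^ N := by
      refine le_trans (by gcongr) (h1.trans (le_of_eq ?_))
      rw [hρ]; congr 2; ring
    have h4 : |f w| ^ p ≤ 2 ^ N * a ^ p := by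
      rw [mul_pow] at h3
      have : 0 < ρ ^ N := by positivity
      nlinarith
    have h5 : (B * a) ^ p = 2 ^ N * a ^ p := by
      rw [Real.mul_rpow hB0.le h0.le, hB, ← Real.rpow_mul (by positivity), one_div,
        inv_mul_cancel₀ hp.ne', Real.rpow_one]
    rw [← h5] at h4
    exact (Real.rpow_le_rpow_iff (abs_nonneg _) (by positivity) hp).1 h4
  have hint : ∫ w in Metric.closedBall w₀ ρ, |f w| ≤ (B * a) ^ (1 - p) * J := by
    have hi1 : IntegrableOn (fun w => |f w|) (Metric.closedBall w₀ ρ) :=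
      (hcont.mono hsub).integrableOn_compact (isCompact_closedBall _ _)
    have hi2 : IntegrableOn (fun w => |f w| ^ p) (Metric.closedBall z r) :=
      hcp.integrableOn_compact (isCompact_closedBall z r)
    calc ∫ w in Metric.closedBall w₀ ρ, |f w|
        ≤ ∫ w in Metric.closedBall w₀ ρ, (B * a) ^ (1 - p) * |f w| ^ p := by
          refine setIntegral_mono_on hi1 ((hi2.mono_set hsub).const_mul _)
            Metric.isClosed_closedBall.measurableSet fun w hw => ?_
          have h6 : |f w| = |f w| ^ (1 - p) * |f w| ^ p := by
            rw [← Real.rpow_add' (abs_nonneg _) (by simp)]; simp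
          have h7 : |f w| ^ (1 - p) ≤ (B * a) ^ (1 - p) :=
            Real.rpow_le_rpow (abs_nonneg _) (hbd w hw) (by linarith)
          calc |f w| = |f w| ^ (1 - p) * |f w| ^ p := h6
            _ ≤ _ := by gcongr
      _ = (B * a) ^ (1 - p) * ∫ w in Metric.closedBall w₀ ρ, |f w| ^ p := integral_const_mul _ _
      _ ≤ (B * a) ^ (1 - p) * J := by
          gcongr
          exact setIntegral_mono_set hi2 (Filter.Eventually.of_forall fun w => by positivity)
            hsub.eventuallyLE
  have h1 := hK' f U hU hf w₀ ρ hρ0 (hsub.trans hzU)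
  have h2 : a ≤ K * (ρ ^ N)⁻¹ * ((B * a) ^ (1 - p) * J) := h1.trans (by gcongr)
  have h8 : r - dist w₀ z = 2 * ρ := by rw [hρ]; ring
  have h9 : a = a ^ p * a ^ (1 - p) := by rw [← Real.rpow_add h0]; simp
  have h10 : a ^ p * a ^ (1 - p) ≤ K * (ρ ^ N)⁻¹ * B ^ (1 - p) * J * a ^ (1 - p) := by
    rw [← h9]
    refine h2.trans (le_of_eq ?_)
    rw [Real.mul_rpow hB0.le h0.le]; ring
  have h11 := le_of_mul_le_mul_right h10 (by positivity)
  rw [h8, mul_pow]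
  calc a ^ p * (2 ^ N * ρ ^ N) ≤ (K * (ρ ^ N)⁻¹ * B ^ (1 - p) * J) * (2 ^ N * ρ ^ N) := by gcongr
    _ = _ := by field_simp

/-- Hardy–Littlewood: positive powers of harmonic functions satisfy a sub-mean value property. -/
lemma ofReal_abs_rpow_le_lintegral (N : ℕ) {p : ℝ} (hp : 0 < p) : ∃ K : ℝ, 0 < K ∧
    ∀ (f : Euc N → ℝ) (U : Set (Euc N)), IsOpen U → HarmonicOnE f U → ∀ (z : Euc N) (r : ℝ),
    0 < r → Metric.closedBall z r ⊆ U →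
    ENNReal.ofReal (|f z| ^ p) ≤
      ENNReal.ofReal (K * (r ^ N)⁻¹) * ∫⁻ w in Metric.closedBall z r, ENNReal.ofReal (|f w| ^ p) := by
  obtain ⟨K, hK, h⟩ : ∃ K : ℝ, 0 < K ∧
      ∀ (f : Euc N → ℝ) (U : Set (Euc N)), IsOpen U → HarmonicOnE f U → ∀ (z : Euc N) (r : ℝ),
      0 < r → Metric.closedBall z r ⊆ U →
      |f z| ^ p ≤ K * (r ^ N)⁻¹ * ∫ w in Metric.closedBall z r, |f w| ^ p := by
    rcases lt_or_ge p 1 with h | h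
    · exact abs_rpow_le_integral_of_lt_one N hp h
    · exact abs_rpow_le_integral_of_one_le N h
  refine ⟨K, hK, fun f U hU hf z r hr hzU => ?_⟩
  have hi : IntegrableOn (fun w => |f w| ^ p) (Metric.closedBall z r) :=
    (((hf.1.continuousOn.mono hzU).abs).rpow_const fun _ _ => Or.inr hp.le).integrableOn_compact
      (isCompact_closedBall z r)
  rw [← ofReal_integral_eq_lintegral_ofReal hi (Filter.Eventually.of_forall fun w => by positivity),
    ← ENNReal.ofReal_mul (by positivity)]
  exact ENNReal.ofReal_le_ofReal (h f U hU hf z r hr hzU)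

@[simp] lemma tp_pt {n : ℕ} (x : Euc n) (t : ℝ) : tp (pt x t) = t := by
  simp [tp, pt]

@[simp] lemma pt_castSucc {n : ℕ} (x : Euc n) (t : ℝ) (i : Fin n) : pt x t i.castSucc = x i := by
  simp [pt]

@[simp] lemma pt_last {n : ℕ} (x : Euc n) (t : ℝ) : pt x t (Fin.last n) = t := tp_pt x t

@[simp] lemma xp_apply {n : ℕ} (z : Euc (n + 1)) (i : Fin n) : xp z i = z i.castSucc := by
  simp [xp]

lemma continuous_tp {n : ℕ} : Continuous (tp (n := n)) := by
  unfold tp; fun_prop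

lemma measurePreserving_pt (n : ℕ) :
    MeasurePreserving (fun z : Euc n × ℝ => pt z.1 z.2) volume volume := by
  have h1 : MeasurePreserving (Prod.map (MeasurableEquiv.toLp 2 (Fin n → ℝ)).symm (id : ℝ → ℝ))
      volume volume :=
    (EuclideanSpace.volume_preserving_symm_measurableEquiv_toLp (Fin n)).prod
      (MeasurePreserving.id volume)
  have h2 : MeasurePreserving (Prod.swap : (Fin n → ℝ) × ℝ → ℝ × (Fin n → ℝ)) volume volume :=
    Measure.measurePreserving_swap
  have h3 := (volume_preserving_piFinSuccAbove (fun _ : Fin (n + 1) => ℝ) (Fin.last n)).symm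
  have h4 := (EuclideanSpace.volume_preserving_symm_measurableEquiv_toLp (Fin (n + 1))).symm
  have h5 : (fun z : Euc n × ℝ => pt z.1 z.2) = (MeasurableEquiv.toLp 2 (Fin (n + 1) → ℝ)).symm.symm ∘
      (MeasurableEquiv.piFinSuccAbove (fun _ : Fin (n + 1) => ℝ) (Fin.last n)).symm ∘
      Prod.swap ∘ Prod.map (MeasurableEquiv.toLp 2 (Fin n → ℝ)).symm (id : ℝ → ℝ) := by
    funext z
    ext i
    refine Fin.lastCases ?_ (fun i => ?_) i
    · simp [MeasurableEquiv.piFinSuccAbove]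
    · simp [MeasurableEquiv.piFinSuccAbove]
  rw [h5]
  exact h4.comp (h3.comp (h2.comp h1))

lemma lintegral_eq_lintegral_pt {n : ℕ} {g : Euc (n + 1) → ℝ≥0∞} (hg : Measurable g) :
    ∫⁻ w, g w = ∫⁻ t : ℝ, ∫⁻ x : Euc n, g (pt x t) := by
  have h := measurePreserving_pt n
  rw [← h.lintegral_comp hg]
  exact lintegral_prod_symm _ (hg.comp h.measurable).aemeasurable

lemma isOpen_upperHS (n : ℕ) : IsOpen (upperHS n) := isOpen_lt continuous_const continuous_tp

lemma abs_coord_sub_le_dist {N : ℕ} (w z : Euc N) (i : Fin N) : |w i - z i| ≤ dist w z := by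
  rw [dist_eq_norm]
  simpa using PiLp.norm_apply_le (w - z) i

lemma closedBall_third_subset {n : ℕ} {z w : Euc (n + 1)}
    (hw : w ∈ Metric.closedBall z (tp z / 3)) : |tp w - tp z| ≤ tp z / 3 :=
  (abs_coord_sub_le_dist w z (Fin.last n)).trans hw

lemma closedBall_third_subset_upperHS {n : ℕ} {z : Euc (n + 1)} (hz : z ∈ upperHS n) :
    Metric.closedBall z (tp z / 3) ⊆ upperHS n := by
  intro w hw
  have h1 := abs_le.1 (closedBall_third_subset hw)
  have hz' : 0 < tp z := hz
  show 0 < tp w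
  linarith

lemma mem_Qcube_of_mem_closedBall {n : ℕ} {z w : Euc (n + 1)}
    (hw : w ∈ Metric.closedBall z (tp z / 3)) : z ∈ Qcube (xp w) (tp w) := by
  have h1 := abs_le.1 (closedBall_third_subset hw)
  refine ⟨fun i => ?_, ?_⟩
  · have := (abs_coord_sub_le_dist w z i.castSucc).trans hw
    rw [xp_apply, abs_sub_comm]
    linarith
  · have := closedBall_third_subset hw
    rw [abs_sub_comm]
    linarith

lemma measurable_indicator_upperHS {n : ℕ} {f : Euc (n + 1) → ℝ} (hf : ContinuousOn f (upperHS n))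
    {p : ℝ} (hp : 0 ≤ p) :
    Measurable ((upperHS n).indicator fun z => ENNReal.ofReal (|f z| ^ p)) := by
  classical
  rw [← Set.piecewise_eq_indicator]
  refine ContinuousOn.measurable_piecewise ?_ continuousOn_const (isOpen_upperHS n).measurableSet
  exact ENNReal.continuous_ofReal.comp_continuousOn (hf.abs.rpow_const fun _ _ => Or.inr hp)

lemma sigmaFinite_restrict_upperHS {n : ℕ} {μ : Measure (Euc (n + 1))}
    (hμ : ∀ (y : Euc n) (r : ℝ), 0 < r → μ (Qcube y r) < ⊤) :
    SigmaFinite (μ.restrict (upperHS n)) := by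
  have hnb : ∀ z ∈ upperHS n, Qcube (xp z) (tp z) ∈ nhdsWithin z (upperHS n) := by
    intro z hz
    have hz' : 0 < tp z := hz
    refine mem_nhdsWithin_of_mem_nhds (Filter.mem_of_superset
      (Metric.closedBall_mem_nhds z (half_pos hz')) fun w hw => ⟨fun i => ?_, ?_⟩)
    · simpa using (abs_coord_sub_le_dist w z i.castSucc).trans hw
    · exact (abs_coord_sub_le_dist w z (Fin.last n)).trans hw
  obtain ⟨t, ht, htc, hcov⟩ := TopologicalSpace.countable_cover_nhdsWithin hnb
  refine Measure.sigmaFinite_of_countable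
    (S := insert (upperHS n)ᶜ ((fun z => Qcube (xp z) (tp z)) '' t)) ((htc.image _).insert _) ?_ ?_
  · rintro s (rfl | ⟨z, hz, rfl⟩)
    · rw [Measure.restrict_apply (isOpen_upperHS n).measurableSet.compl]
      simp
    · exact (Measure.restrict_apply_le _ _).trans_lt (hμ _ _ (ht hz))
  · refine eq_univ_of_forall fun z => ?_
    by_cases hz : z ∈ upperHS n
    · obtain ⟨y, hy, hzy⟩ := mem_iUnion₂.1 (hcov hz)
      exact ⟨_, Or.inr ⟨y, hy, rfl⟩, hzy⟩
    · exact ⟨_, Or.inl rfl, hz⟩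

/-- Integrals against a Carleson measure are dominated by a weighted volume integral for functions
with a sub-mean value property. -/
lemma lintegral_carleson_le {n : ℕ} {μ : Measure (Euc (n + 1))} {C θ K : ℝ}
    (hC : 0 ≤ C) (hK : 0 ≤ K)
    (hμ : ∀ (y : Euc n) (r : ℝ), 0 < r → μ (Qcube y r) ≤ ENNReal.ofReal (C * r ^ θ))
    {g : Euc (n + 1) → ℝ≥0∞} (hg : Measurable g) (hg0 : ∀ z, z ∉ upperHS n → g z = 0)
    (hsub : ∀ z ∈ upperHS n, g z ≤ ENNReal.ofReal (K * ((tp z / 3) ^ (n + 1))⁻¹) *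
      ∫⁻ w in Metric.closedBall z (tp z / 3), g w) :
    ∫⁻ z in upperHS n, g z ∂μ ≤ ENNReal.ofReal (K * 4 ^ (n + 1) * C) *
      ∫⁻ t in Ioi (0 : ℝ), ENNReal.ofReal (t ^ (θ - (n + 1))) * ∫⁻ x : Euc n, g (pt x t) := by
  have hsf : SigmaFinite (μ.restrict (upperHS n)) :=
    sigmaFinite_restrict_upperHS fun y r hr => (hμ y r hr).trans_lt ENNReal.ofReal_lt_top
  set ν := μ.restrict (upperHS n) with hν
  set T : Set (Euc (n + 1) × Euc (n + 1)) := {a | dist a.2 a.1 ≤ tp a.1 / 3} with hT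
  have hTm : MeasurableSet T := by
    refine (isClosed_le (by fun_prop) ?_).measurableSet
    exact (continuous_tp.comp continuous_fst).div_const _
  set k : Euc (n + 1) → ℝ≥0∞ := fun w => ENNReal.ofReal (K * 4 ^ (n + 1) * (tp w ^ (n + 1))⁻¹) with hk
  have hkm : Measurable k := by
    have := (continuous_tp (n := n)).measurable
    fun_prop
  set H : Euc (n + 1) × Euc (n + 1) → ℝ≥0∞ := T.indicator fun a => k a.2 * g a.2 with hH
  have hHm : Measurable H := by
    refine Measurable.indicator ?_ hTm
    exact (hkm.comp measurable_snd).mul (hg.comp measurable_snd)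
  have hpt : ∀ z ∈ upperHS n, g z ≤ ∫⁻ w, H (z, w) := by
    intro z hz
    have hz' : 0 < tp z := hz
    refine (hsub z hz).trans ?_
    rw [← lintegral_const_mul _ hg, ← lintegral_indicator Metric.isClosed_closedBall.measurableSet]
    refine lintegral_mono fun w => ?_
    by_cases hw : w ∈ Metric.closedBall z (tp z / 3)
    · have hw' : (z, w) ∈ T := hw
      simp only [hH, indicator_of_mem hw, indicator_of_mem hw']
      gcongr
      simp only [hk]
      refine ENNReal.ofReal_le_ofReal ?_
      rw [mul_assoc]
      refine mul_le_mul_of_nonneg_left ?_ hK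
      have h1 := abs_le.1 (closedBall_third_subset hw)
      have h2 : 0 < tp w := by linarith
      rw [← div_eq_mul_inv, le_div_iff₀ (by positivity), inv_mul_le_iff₀ (by positivity), ← mul_pow]
      refine pow_le_pow_left₀ h2.le ?_ _
      linarith
    · simp [indicator_of_notMem hw]
  calc ∫⁻ z in upperHS n, g z ∂μ ≤ ∫⁻ z, (∫⁻ w, H (z, w)) ∂ν :=
        setLIntegral_mono' (isOpen_upperHS n).measurableSet hpt
    _ = ∫⁻ w, (∫⁻ z, H (z, w) ∂ν) := 
        lintegral_lintegral_swap (μ := ν) (ν := volume) (f := fun z w => H (z, w)) hHm.aemeasurable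
    _ ≤ ∫⁻ w, ENNReal.ofReal (K * 4 ^ (n + 1) * C) * (ENNReal.ofReal (tp w ^ (θ - (n + 1))) * g w) := by
        refine lintegral_mono fun w => ?_
        by_cases hw : w ∈ upperHS n
        · have hw' : 0 < tp w := hw
          have hTw : MeasurableSet {z | (z, w) ∈ T} := measurable_prodMk_right hTm
          have h1 : ∀ z, H (z, w) = {z | (z, w) ∈ T}.indicator (fun _ => k w * g w) z := by
            intro z; simp [hH, indicator]
          simp only [h1]
          rw [lintegral_indicator_const hTw]
          have h2 : ν {z | (z, w) ∈ T} ≤ ENNReal.ofReal (C * tp w ^ θ) := by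
            rw [hν, Measure.restrict_apply hTw]
            refine (measure_mono ?_).trans (hμ (xp w) (tp w) hw')
            rintro z ⟨hz1, -⟩
            exact mem_Qcube_of_mem_closedBall hz1
          have h3 : (tp w ^ (n + 1))⁻¹ * tp w ^ θ = tp w ^ (θ - (n + 1)) := by
            rw [Real.rpow_sub hw', mul_comm, ← div_eq_mul_inv]
            congr 1
            exact_mod_cast (Real.rpow_natCast (tp w) (n + 1)).symm
          calc k w * g w * ν {z | (z, w) ∈ T} ≤ k w * g w * ENNReal.ofReal (C * tp w ^ θ) := by gcongr
            _ = k w * ENNReal.ofReal (C * tp w ^ θ) * g w := by ring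
            _ = _ := by
              rw [hk, ← ENNReal.ofReal_mul (by positivity),
                ← mul_assoc (ENNReal.ofReal (K * 4 ^ (n + 1) * C)),
                ← ENNReal.ofReal_mul (show 0 ≤ K * 4 ^ (n + 1) * C by positivity), ← h3]
              congr 2; ring
        · have h1 : ∀ z, H (z, w) = 0 := fun z => by simp [hH, indicator, hg0 w hw]
          simp [h1]
    _ = ENNReal.ofReal (K * 4 ^ (n + 1) * C) * ∫⁻ t : ℝ, ∫⁻ x : Euc n,
          ENNReal.ofReal (t ^ (θ - (n + 1))) * g (pt x t) := by
        have hm : Measurable fun w : Euc (n + 1) => ENNReal.ofReal (tp w ^ (θ - (n + 1))) * g w := by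
          have := (continuous_tp (n := n)).measurable
          fun_prop
        rw [lintegral_const_mul _ hm, lintegral_eq_lintegral_pt hm]
        simp only [tp_pt]
    _ ≤ _ := by
        refine mul_le_mul_right ?_ _
        rw [← lintegral_indicator measurableSet_Ioi]
        refine lintegral_mono fun t => ?_
        have hgm : Measurable fun x : Euc n => g (pt x t) :=
          (hg.comp (measurePreserving_pt n).measurable).comp measurable_prodMk_right
        rcases lt_or_ge 0 t with ht | ht
        · rw [indicator_of_mem (mem_Ioi.2 ht), lintegral_const_mul _ hgm]
        · have : ∀ x : Euc n, g (pt x t) = 0 := fun x => hg0 _ (by simpa [upperHS] using ht)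
          simp [this]

lemma rpow_lintegral_le {X : Type*} [MeasurableSpace X] {ν : Measure X} {r : ℝ} (hr : 1 ≤ r)
    {F : X → ℝ≥0∞} (hF : Measurable F) :
    (∫⁻ x, F x ∂ν) ^ r ≤ ν univ ^ (r - 1) * ∫⁻ x, F x ^ r ∂ν := by
  have hr0 : 0 < r := by linarith
  have h := eLpNorm'_le_eLpNorm'_mul_rpow_measure_univ one_pos hr hF.aestronglyMeasurable (μ := ν)
  simp only [eLpNorm', enorm_eq_self, ENNReal.rpow_one, div_one, one_div] at h
  have h2 := ENNReal.rpow_le_rpow h hr0.le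
  rw [ENNReal.mul_rpow_of_nonneg _ _ hr0.le, ← ENNReal.rpow_mul, ← ENNReal.rpow_mul,
    inv_mul_cancel₀ hr0.ne', ENNReal.rpow_one, mul_comm] at h2
  refine h2.trans (le_of_eq ?_)
  congr 2
  field_simp

lemma mul_rpow_sub_one_le {r : ℝ} (hr : 1 ≤ r) (a b : ℝ≥0∞) : a * b ^ (r - 1) ≤ a ^ r + b ^ r := by
  have h : ∀ x : ℝ≥0∞, x * x ^ (r - 1) = x ^ r := by
    intro x
    conv_lhs => rw [← ENNReal.rpow_one x, ← ENNReal.rpow_mul, one_mul]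
    rw [← ENNReal.rpow_add_of_nonneg _ _ zero_le_one (by linarith)]
    congr 1; ring
  rcases le_total a b with hab | hab
  · calc a * b ^ (r - 1) ≤ b * b ^ (r - 1) := by gcongr
      _ = b ^ r := h b
      _ ≤ _ := le_add_self
  · calc a * b ^ (r - 1) ≤ a * a ^ (r - 1) := by
          gcongr
      _ = a ^ r := h a
      _ ≤ _ := le_self_add

/-- Averaging over multiplicative windows is bounded on power-weighted `L¹`. -/
lemma lintegral_window_le (c : ℝ) {F : ℝ → ℝ≥0∞} (hF : Measurable F) :
    ∫⁻ s in Ioi (0 : ℝ), ENNReal.ofReal (s ^ c) * ∫⁻ t in Icc (s / 2) (3 * s / 2), F t ≤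
      ENNReal.ofReal (2 ^ |c| * 2) * ∫⁻ t in Ioi (0 : ℝ), F t * ENNReal.ofReal (t ^ (c + 1)) := by
  set T : Set (ℝ × ℝ) := {a | 0 < a.1 ∧ a.1 / 2 ≤ a.2 ∧ a.2 ≤ 3 * a.1 / 2} with hT
  have hTm : MeasurableSet T :=
    (measurableSet_lt measurable_const measurable_fst).inter
      ((measurableSet_le (f := fun a : ℝ × ℝ => a.1 / 2) (g := fun a => a.2)
          (by fun_prop) (by fun_prop)).inter
        (measurableSet_le (f := fun a : ℝ × ℝ => a.2) (g := fun a => 3 * a.1 / 2)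
          (by fun_prop) (by fun_prop)))
  set H : ℝ × ℝ → ℝ≥0∞ := T.indicator fun a => ENNReal.ofReal (a.1 ^ c) * F a.2 with hH
  have hHm : Measurable H := by
    refine Measurable.indicator ?_ hTm
    have h : Measurable fun a : ℝ × ℝ => F a.2 := hF.comp measurable_snd
    exact Measurable.mul (by fun_prop) h
  have h1 : ∫⁻ s in Ioi (0 : ℝ), ENNReal.ofReal (s ^ c) * ∫⁻ t in Icc (s / 2) (3 * s / 2), F t
      = ∫⁻ s : ℝ, ∫⁻ t : ℝ, H (s, t) := by
    rw [← lintegral_indicator measurableSet_Ioi]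
    refine lintegral_congr fun s => ?_
    by_cases hs : s ∈ Ioi (0 : ℝ)
    · rw [indicator_of_mem hs, ← lintegral_const_mul _ hF, ← lintegral_indicator measurableSet_Icc]
      refine lintegral_congr fun t => ?_
      have hs' : 0 < s := hs
      simp [hH, hT, indicator, hs']
    · rw [indicator_of_notMem hs]
      have hs' : ¬ 0 < s := hs
      simp [hH, hT, hs']
  rw [h1, lintegral_lintegral_swap (f := fun s t => H (s, t)) hHm.aemeasurable,
    ← lintegral_const_mul' _ _ ENNReal.ofReal_ne_top, ← lintegral_indicator measurableSet_Ioi]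
  refine lintegral_mono fun t => ?_
  by_cases ht : t ∈ Ioi (0 : ℝ)
  · have ht' : 0 < t := ht
    rw [indicator_of_mem ht]
    calc ∫⁻ s : ℝ, H (s, t)
        ≤ ∫⁻ s : ℝ, (Icc (t / 2) (2 * t)).indicator
            (fun _ => ENNReal.ofReal (2 ^ |c| * t ^ c) * F t) s := by
          refine lintegral_mono fun s => ?_
          by_cases hs : (s, t) ∈ T
          · obtain ⟨hs0, hs1, hs2⟩ := hs
            have hm : s ∈ Icc (t / 2) (2 * t) := by
              simp only at hs0 hs1 hs2
              constructor <;> linarith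
            rw [indicator_of_mem hm, hH, indicator_of_mem (show (s, t) ∈ T from ⟨hs0, hs1, hs2⟩)]
            refine mul_le_mul_left (ENNReal.ofReal_le_ofReal ?_) _
            have hq : s ^ c = (s / t) ^ c * t ^ c := by
              rw [← Real.mul_rpow (by positivity) ht'.le, div_mul_cancel₀ _ ht'.ne']
            simp only
            rw [hq]
            refine mul_le_mul_of_nonneg_right ?_ (by positivity)
            have hb1 : s / t ≤ 2 := by rw [div_le_iff₀ ht']; exact hm.2
            have hb2 : 2⁻¹ ≤ s / t := by rw [le_div_iff₀ ht']; linarith [hm.1]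
            rcases le_total 0 c with hc | hc
            · rw [abs_of_nonneg hc]
              exact Real.rpow_le_rpow (by positivity) hb1 hc
            · rw [abs_of_nonpos hc, Real.rpow_neg (by norm_num), ← Real.inv_rpow (by norm_num)]
              exact Real.rpow_le_rpow_of_nonpos (by norm_num) hb2 hc
          · simp [hH, indicator_of_notMem hs]
      _ = ENNReal.ofReal (2 ^ |c| * t ^ c) * F t * ENNReal.ofReal (2 * t - t / 2) := by
          rw [lintegral_indicator_const measurableSet_Icc, Real.volume_Icc]
      _ ≤ ENNReal.ofReal (2 ^ |c| * t ^ c) * F t * ENNReal.ofReal (2 * t) := by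
          gcongr; linarith
      _ = ENNReal.ofReal (2 ^ |c| * t ^ c * (2 * t)) * F t := by
          rw [ENNReal.ofReal_mul (show 0 ≤ 2 ^ |c| * t ^ c by positivity)]; ring
      _ = ENNReal.ofReal (2 ^ |c| * 2 * t ^ (c + 1)) * F t := by
          rw [Real.rpow_add ht', Real.rpow_one]; congr 2; ring
      _ = _ := by
          rw [ENNReal.ofReal_mul (by positivity)]; ring
  · have : ∀ s, H (s, t) = 0 := fun s => by
      refine indicator_of_notMem ?_ _
      rintro ⟨h1, h2, -⟩
      simp only at h1 h2
      exact ht (show 0 < t by linarith)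
    simp [this]

/-- Weighted volume integrals of powers are controlled by the mixed norm. -/
lemma lintegral_rpow_le_mixed {n : ℕ} {r β K : ℝ} (hr : 1 ≤ r) (hK : 0 ≤ K)
    {G : Euc (n + 1) → ℝ≥0∞} (hG : Measurable G)
    (hsub : ∀ z ∈ upperHS n, G z ≤ ENNReal.ofReal (K * ((tp z / 3) ^ (n + 1))⁻¹) *
      ∫⁻ w in Metric.closedBall z (tp z / 3), G w) :
    ∫⁻ t in Ioi (0 : ℝ), ENNReal.ofReal (t ^ (n * r + β - (n + 1))) * ∫⁻ x : Euc n, G (pt x t) ^ r ≤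
      ENNReal.ofReal ((K * 3 ^ (n + 1)) ^ (r - 1) * (1 + 2 ^ |β - 2| * 2)) *
        ∫⁻ t in Ioi (0 : ℝ), (∫⁻ x : Euc n, G (pt x t)) ^ r * ENNReal.ofReal (t ^ (β - 1)) := by
  have hptm := (measurePreserving_pt n).measurable
  set I : ℝ → ℝ≥0∞ := fun t => ∫⁻ x : Euc n, G (pt x t) with hI
  have hIm : Measurable I := (hG.comp hptm).lintegral_prod_left'
  have hIr : Measurable fun t => I t ^ r := hIm.pow_const r
  set L := K * 3 ^ (n + 1) with hL
  have hL0 : 0 ≤ L := by positivity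
  have hpw : ∀ s, 0 < s → ∀ x : Euc n, G (pt x s) ≤ ENNReal.ofReal (L * (s ^ (n : ℝ))⁻¹) *
      (ENNReal.ofReal s⁻¹ * ∫⁻ t in Icc (s / 2) (3 * s / 2), I t) := by
    intro s hs x
    have h1 := hsub (pt x s) (by simpa [upperHS] using hs)
    rw [tp_pt] at h1
    have h2 : ∫⁻ w in Metric.closedBall (pt x s) (s / 3), G w
        ≤ ∫⁻ t in Icc (s / 2) (3 * s / 2), I t := by
      have hSm : MeasurableSet {w : Euc (n + 1) | tp w ∈ Icc (s / 2) (3 * s / 2)} :=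
        continuous_tp.measurable measurableSet_Icc
      calc ∫⁻ w in Metric.closedBall (pt x s) (s / 3), G w
          ≤ ∫⁻ w in {w : Euc (n + 1) | tp w ∈ Icc (s / 2) (3 * s / 2)}, G w := by
            refine lintegral_mono_set fun w hw => ?_
            have h3 := abs_le.1 (closedBall_third_subset (z := pt x s) (by rwa [tp_pt]))
            rw [tp_pt] at h3
            constructor <;> linarith
        _ = ∫⁻ t in Icc (s / 2) (3 * s / 2), I t := by
            rw [← lintegral_indicator hSm, lintegral_eq_lintegral_pt (hG.indicator hSm),
              ← lintegral_indicator measurableSet_Icc]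
            refine lintegral_congr fun t => ?_
            by_cases ht : t ∈ Icc (s / 2) (3 * s / 2)
            · rw [indicator_of_mem ht]
              refine lintegral_congr fun x => indicator_of_mem (by simpa using ht) _
            · rw [indicator_of_notMem ht]
              refine lintegral_eq_zero_of_ae_eq_zero (Filter.Eventually.of_forall fun x =>
                indicator_of_notMem (by simpa using ht) _)
    refine h1.trans ?_
    rw [← mul_assoc, ← ENNReal.ofReal_mul (by positivity)]
    refine mul_le_mul' (le_of_eq ?_) h2
    rw [hL, Real.rpow_natCast]
    congr 1
    rw [div_pow]; field_simp; ring
  have hs : ∀ s ∈ Ioi (0 : ℝ),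
      ENNReal.ofReal (s ^ (n * r + β - (n + 1))) * ∫⁻ x : Euc n, G (pt x s) ^ r ≤
      ENNReal.ofReal (L ^ (r - 1)) * (I s ^ r * ENNReal.ofReal (s ^ (β - 1)) +
        ENNReal.ofReal (s ^ (β - 2)) * ∫⁻ t in Icc (s / 2) (3 * s / 2), I t ^ r) := by
    intro s hs
    have hs' : 0 < s := hs
    set A := ENNReal.ofReal s⁻¹ * ∫⁻ t in Icc (s / 2) (3 * s / 2), I t with hA
    have hAr : A ^ r ≤ ENNReal.ofReal s⁻¹ * ∫⁻ t in Icc (s / 2) (3 * s / 2), I t ^ r := by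
      have hj := rpow_lintegral_le (ν := volume.restrict (Icc (s / 2) (3 * s / 2))) hr hIm
      rw [Measure.restrict_apply_univ, Real.volume_Icc,
        show 3 * s / 2 - s / 2 = s by ring, ENNReal.ofReal_rpow_of_pos hs'] at hj
      rw [hA, ENNReal.mul_rpow_of_nonneg _ _ (by linarith),
        ENNReal.ofReal_rpow_of_pos (by positivity)]
      refine (mul_le_mul_right hj _).trans (le_of_eq ?_)
      rw [← mul_assoc, ← ENNReal.ofReal_mul (by positivity)]
      congr 2
      rw [Real.inv_rpow hs'.le, Real.rpow_sub hs', Real.rpow_one]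
      field_simp
    have hGr : ∀ x : Euc n, G (pt x s) ^ r ≤
        G (pt x s) * (ENNReal.ofReal (L * (s ^ (n : ℝ))⁻¹) * A) ^ (r - 1) := by
      intro x
      have : G (pt x s) ^ r = G (pt x s) * G (pt x s) ^ (r - 1) := by
        conv_rhs => rw [← ENNReal.rpow_one (G (pt x s)), ← ENNReal.rpow_mul, one_mul]
        rw [← ENNReal.rpow_add_of_nonneg _ _ zero_le_one (by linarith)]
        congr 1; ring
      rw [this]
      exact mul_le_mul_right (ENNReal.rpow_le_rpow (hpw s hs' x) (by linarith)) _
    have hGx : Measurable fun x : Euc n => G (pt x s) := (hG.comp hptm).comp measurable_prodMk_right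
    have hpow : s ^ (n * r + β - (n + 1)) * (L * (s ^ (n : ℝ))⁻¹) ^ (r - 1)
        = L ^ (r - 1) * s ^ (β - 1) := by
      rw [Real.mul_rpow hL0 (by positivity), ← Real.rpow_neg hs'.le, ← Real.rpow_mul hs'.le,
        mul_left_comm, ← Real.rpow_add hs']
      congr 2; ring
    calc ENNReal.ofReal (s ^ (n * r + β - (n + 1))) * ∫⁻ x : Euc n, G (pt x s) ^ r
        ≤ ENNReal.ofReal (s ^ (n * r + β - (n + 1))) *
            ∫⁻ x : Euc n, G (pt x s) * (ENNReal.ofReal (L * (s ^ (n : ℝ))⁻¹) * A) ^ (r - 1) :=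
          mul_le_mul_right (lintegral_mono hGr) _
      _ = ENNReal.ofReal (s ^ (n * r + β - (n + 1))) *
            (I s * (ENNReal.ofReal ((L * (s ^ (n : ℝ))⁻¹) ^ (r - 1)) * A ^ (r - 1))) := by
          rw [lintegral_mul_const _ hGx, ENNReal.mul_rpow_of_nonneg _ _ (by linarith),
            ENNReal.ofReal_rpow_of_nonneg (by positivity) (by linarith)]
      _ = ENNReal.ofReal (L ^ (r - 1) * s ^ (β - 1)) * (I s * A ^ (r - 1)) := by
          rw [← hpow, ENNReal.ofReal_mul (by positivity)]; ring
      _ ≤ ENNReal.ofReal (L ^ (r - 1) * s ^ (β - 1)) * (I s ^ r +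
            ENNReal.ofReal s⁻¹ * ∫⁻ t in Icc (s / 2) (3 * s / 2), I t ^ r) :=
          mul_le_mul_right ((mul_rpow_sub_one_le hr _ _).trans (add_le_add_right hAr _)) _
      _ = _ := by
          have h5 : s ^ (β - 2) = s ^ (β - 1) * s⁻¹ := by
            rw [← Real.rpow_neg_one s, ← Real.rpow_add hs']; congr 1; ring
          rw [h5, ENNReal.ofReal_mul (show 0 ≤ L ^ (r - 1) by positivity),
            ENNReal.ofReal_mul (show 0 ≤ s ^ (β - 1) by positivity)]
          ring
  refine (setLIntegral_mono' measurableSet_Ioi hs).trans ?_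
  rw [lintegral_const_mul' _ _ ENNReal.ofReal_ne_top,
    lintegral_add_left (by fun_prop), ENNReal.ofReal_mul (by positivity), mul_assoc,
    ENNReal.ofReal_add (by positivity) (by positivity), add_mul, ENNReal.ofReal_one, one_mul]
  have hw := lintegral_window_le (β - 2) hIr
  rw [show β - 2 + 1 = β - 1 by ring] at hw
  exact mul_le_mul_right (add_le_add_right hw _) _

lemma normB_rpow {n : ℕ} (f : Euc (n + 1) → ℝ) {p q : ℝ} (hq : 0 < q) (α : ℝ) :
    normB n f q p α ^ q = ∫⁻ t in Ioi (0 : ℝ),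
      (∫⁻ x : Euc n, ENNReal.ofReal (|f (pt x t)| ^ p)) ^ (q / p) * ENNReal.ofReal (t ^ (α * q - 1)) := by
  rw [normB, ← ENNReal.rpow_mul, one_div, inv_mul_cancel₀ hq.ne', ENNReal.rpow_one]
  refine lintegral_congr fun t => ?_
  rw [Mp, ← ENNReal.rpow_mul]
  congr 2; ring

/-- The Carleson condition implies the embedding. -/
lemma embedding_of_carleson {n : ℕ} {p q : ℝ} (hp : 0 < p) (hpq : p ≤ q) (α : ℝ)
    {μ : Measure (Euc (n + 1))} {C : ℝ} (hC : 0 < C)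
    (hμ : ∀ (y : Euc n) (r : ℝ), 0 < r →
      μ (Qcube y r) ≤ ENNReal.ofReal (C * r ^ ((n : ℝ) * q / p + α * q))) :
    ∃ C' : ℝ, 0 < C' ∧ ∀ f : Euc (n + 1) → ℝ, HarmonicOnE f (upperHS n) →
      (∫⁻ z in upperHS n, ENNReal.ofReal (|f z| ^ q) ∂μ) ≤
        ENNReal.ofReal C' * (normB n f q p α) ^ q := by
  have hq : 0 < q := hp.trans_le hpq
  obtain ⟨Kp, hKp, hp'⟩ := ofReal_abs_rpow_le_lintegral (n + 1) hp
  obtain ⟨Kq, hKq, hq'⟩ := ofReal_abs_rpow_le_lintegral (n + 1) hq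
  have hr : 1 ≤ q / p := by rwa [le_div_iff₀ hp, one_mul]
  refine ⟨Kq * 4 ^ (n + 1) * C * ((Kp * 3 ^ (n + 1)) ^ (q / p - 1) * (1 + 2 ^ |α * q - 2| * 2)),
    by positivity, fun f hf => ?_⟩
  let g : ℝ → Euc (n + 1) → ℝ≥0∞ := fun a =>
    (upperHS n).indicator fun z => ENNReal.ofReal (|f z| ^ a)
  have hgm : ∀ a, 0 ≤ a → Measurable (g a) := fun a ha =>
    measurable_indicator_upperHS hf.1.continuousOn ha
  have hgsub : ∀ a K, (∀ (f : Euc (n + 1) → ℝ) (U : Set (Euc (n + 1))), IsOpen U →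
      HarmonicOnE f U → ∀ z r, 0 < r → Metric.closedBall z r ⊆ U → ENNReal.ofReal (|f z| ^ a) ≤
      ENNReal.ofReal (K * (r ^ (n + 1))⁻¹) *
        ∫⁻ w in Metric.closedBall z r, ENNReal.ofReal (|f w| ^ a)) →
      ∀ z ∈ upperHS n, g a z ≤ ENNReal.ofReal (K * ((tp z / 3) ^ (n + 1))⁻¹) *
        ∫⁻ w in Metric.closedBall z (tp z / 3), g a w := by
    intro a K h z hz
    have hz' : 0 < tp z := hz
    have hsubset := closedBall_third_subset_upperHS hz
    simp only [g]
    rw [indicator_of_mem hz]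
    refine (h f _ (isOpen_upperHS n) hf z (tp z / 3) (by positivity) hsubset).trans (le_of_eq ?_)
    congr 1
    exact setLIntegral_congr_fun Metric.isClosed_closedBall.measurableSet fun w hw =>
      (indicator_of_mem (hsubset hw) (fun z => ENNReal.ofReal (|f z| ^ a))).symm
  have hpt : ∀ a t, 0 < t → ∀ x : Euc n, g a (pt x t) = ENNReal.ofReal (|f (pt x t)| ^ a) :=
    fun a t ht x => indicator_of_mem (show pt x t ∈ upperHS n by simpa [upperHS] using ht) _
  have hgr : ∀ z, g q z = g p z ^ (q / p) := by
    intro z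
    by_cases hz : z ∈ upperHS n
    · simp only [g, indicator_of_mem hz]
      rw [ENNReal.ofReal_rpow_of_nonneg (by positivity) (by positivity),
        ← Real.rpow_mul (abs_nonneg _), mul_div_cancel₀ _ hp.ne']
    · simp only [g, indicator_of_notMem hz]
      rw [ENNReal.zero_rpow_of_pos (by positivity)]
  have h1 := lintegral_carleson_le hC.le hKq.le hμ (hgm q hq.le)
    (fun z hz => indicator_of_notMem hz _) (hgsub q Kq hq')
  have h2 := lintegral_rpow_le_mixed (β := α * q) hr hKp.le (hgm p hp.le) (hgsub p Kp hp')
  have h3 : ∫⁻ z in upperHS n, ENNReal.ofReal (|f z| ^ q) ∂μ = ∫⁻ z in upperHS n, g q z ∂μ :=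
    setLIntegral_congr_fun (isOpen_upperHS n).measurableSet fun w hw =>
      (indicator_of_mem hw (fun z => ENNReal.ofReal (|f z| ^ q))).symm
  have h4 : ∫⁻ t in Ioi (0 : ℝ), (∫⁻ x : Euc n, g p (pt x t)) ^ (q / p) *
      ENNReal.ofReal (t ^ (α * q - 1)) = normB n f q p α ^ q := by
    rw [normB_rpow f hq]
    refine setLIntegral_congr_fun measurableSet_Ioi fun t ht => ?_
    simp only [hpt p t ht]
  simp only [hgr] at h1
  rw [h3, ← h4, ENNReal.ofReal_mul (by positivity), mul_assoc]
  simp only [hgr]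
  refine h1.trans (mul_le_mul_right ?_ _)
  rwa [← mul_div_assoc] at h2

/-- Second directional derivatives can be computed along lines. -/
lemma d2_eq_of_hasDerivAt {V : Type*} [NormedAddCommGroup V] [NormedSpace ℝ V] {f : V → ℝ}
    {z v : V} (hf : ContDiffAt ℝ 2 f z) {g : ℝ → ℝ} {c : ℝ}
    (hg : ∀ᶠ s in nhds (0 : ℝ), HasDerivAt (fun s => f (z + s • v)) (g s) s)
    (hc : HasDerivAt g c 0) : d2 f z v = c := by
  have hline : ∀ s : ℝ, HasDerivAt (fun s : ℝ => z + s • v) v s := fun s => by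
    simpa using ((hasDerivAt_id s).smul_const v).const_add z
  have hz : Filter.Tendsto (fun s : ℝ => z + s • v) (nhds 0) (nhds z) := by
    simpa using (hline 0).continuousAt.tendsto
  have h1 : ∀ᶠ w in nhds z, DifferentiableAt ℝ f w :=
    (hf.eventually (by simp)).mono fun w hw => hw.differentiableAt (by norm_num)
  have h2 : g =ᶠ[nhds 0] fun s => fderiv ℝ f (z + s • v) v := by
    filter_upwards [hg, hz.eventually h1] with s hs hs'
    exact hs.unique (hs'.hasFDerivAt.comp_hasDerivAt s (hline s))
  have h3 : HasFDerivAt (fderiv ℝ f) (fderiv ℝ (fderiv ℝ f) z) z :=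
    ((hf.fderiv_right (m := 1) (by norm_num)).differentiableAt (by norm_num)).hasFDerivAt
  have h3' : HasFDerivAt (fderiv ℝ f) (fderiv ℝ (fderiv ℝ f) z) (z + (0 : ℝ) • v) := by
    simpa using h3
  have h4 : HasDerivAt (fun s : ℝ => fderiv ℝ f (z + s • v) v) (fderiv ℝ (fderiv ℝ f) z v v) 0 :=
    ((ContinuousLinearMap.apply ℝ ℝ v).hasFDerivAt.comp_hasDerivAt (0 : ℝ)
      (h3'.comp_hasDerivAt (0 : ℝ) (hline 0)))
  have h5 : HasDerivAt g (fderiv ℝ (fderiv ℝ f) z v v) 0 := h4.congr_of_eventuallyEq h2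
  rw [d2, iteratedFDeriv_two_apply]
  simpa using h5.unique hc

/-- The Kelvin-type transform of the `k`-th power of the complex linear form `∑ i, l i * z i`. -/
def kelvinPower {N : ℕ} (l : Fin N → ℂ) (k : ℕ) (a : ℝ) (z : Euc N) : ℝ :=
  ((∑ i, l i * z i) ^ k * (((‖z‖ ^ 2) ^ (-a) : ℝ) : ℂ)).re

lemma contDiffAt_kelvinPower {N : ℕ} (l : Fin N → ℂ) (k : ℕ) (a : ℝ) {z : Euc N} (hz : z ≠ 0) :
    ContDiffAt ℝ 2 (kelvinPower l k a) z := by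
  have h1 : ContDiffAt ℝ 2 (fun z : Euc N => (‖z‖ ^ 2) ^ (-a)) z :=
    (contDiff_norm_sq ℝ).contDiffAt.rpow_const_of_ne (by positivity)
  have h2 : ContDiffAt ℝ 2 (fun z : Euc N => (((‖z‖ ^ 2) ^ (-a) : ℝ) : ℂ)) z :=
    Complex.ofRealCLM.contDiff.contDiffAt.comp z h1
  have h3 : ∀ i : Fin N, ContDiff ℝ 2 (fun z : Euc N => ((z i : ℝ) : ℂ)) := fun i =>
    Complex.ofRealCLM.contDiff.comp (by fun_prop : ContDiff ℝ 2 (fun z : Euc N => z i))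
  have h4 : ContDiff ℝ 2 (fun z : Euc N => (∑ i, l i * z i) ^ k) :=
    (ContDiff.sum fun i _ => contDiff_const.mul (h3 i)).pow k
  exact Complex.reCLM.contDiff.contDiffAt.comp z (h4.contDiffAt.mul h2)

lemma d2_kelvinPower {N : ℕ} (l : Fin N → ℂ) (j : ℕ) (a : ℝ) {z : Euc N} (hz : z ≠ 0)
    (i : Fin N) :
    d2 (kelvinPower l (j + 2) a) z (EuclideanSpace.single i 1) =
      ((∑ i, l i * z i) ^ j * (((‖z‖ ^ 2) ^ (-a - 2) : ℝ) : ℂ) *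
        ((j + 2) * (j + 1) * l i ^ 2 * (‖z‖ : ℂ) ^ 4
          - 4 * a * (j + 2) * (∑ i, l i * z i) * (l i * z i) * (‖z‖ : ℂ) ^ 2
          - 2 * a * (∑ i, l i * z i) ^ 2 * (‖z‖ : ℂ) ^ 2
          + 4 * a * (a + 1) * (∑ i, l i * z i) ^ 2 * (z i : ℂ) ^ 2)).re := by
  set L : ℂ := ∑ i, l i * z i with hL
  set e : Euc N := EuclideanSpace.single i 1 with he
  have hLs : ∀ s : ℝ, ∑ m, l m * ((z + s • e) m : ℂ) = L + s * l i := by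
    intro s
    simp only [PiLp.add_apply, PiLp.smul_apply, smul_eq_mul, Complex.ofReal_add, mul_add,
      Finset.sum_add_distrib, ← hL]
    congr 1
    rw [Finset.sum_eq_single i]
    · simp [he, mul_comm]
    · intro m _ hm; simp [he, hm]
    · simp
  have hρs : ∀ s : ℝ, ‖z + s • e‖ ^ 2 = ‖z‖ ^ 2 + 2 * s * z i + s ^ 2 := by
    intro s
    rw [norm_add_sq_real, inner_smul_right, norm_smul, he, EuclideanSpace.inner_single_right]
    simp; ring
  have hρ0 : 0 < ‖z‖ ^ 2 := by positivity
  set r : ℝ → ℝ := fun s => ‖z‖ ^ 2 + 2 * s * z i + s ^ 2 with hr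
  have hr0 : r 0 = ‖z‖ ^ 2 := by simp [hr]
  have hrd : ∀ s, HasDerivAt r (2 * z i + 2 * s) s := by
    intro s
    have := ((((hasDerivAt_id s).const_mul 2).mul_const (z i)).const_add (‖z‖ ^ 2)).add
      ((hasDerivAt_id s).pow 2)
    refine this.congr_deriv ?_
    simp
  have hrp : ∀ (b : ℝ) (s : ℝ), 0 < r s → HasDerivAt (fun s => (((r s) ^ b : ℝ) : ℂ))
      (((2 * z i + 2 * s) * b * (r s) ^ (b - 1) : ℝ) : ℂ) s := fun b s hs =>
    ((hrd s).rpow_const (p := b) (Or.inl hs.ne')).ofReal_comp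
  have hM : ∀ (k : ℕ) (s : ℝ), HasDerivAt (fun s : ℝ => (L + s * l i) ^ (k + 1))
      ((k + 1) * (L + s * l i) ^ k * l i) s := by
    intro k s
    have h : HasDerivAt (fun s : ℝ => L + s * l i) (l i) s := by
      simpa using (((hasDerivAt_id s).ofReal_comp).mul_const (l i)).const_add L
    refine (h.pow (k + 1)).congr_deriv ?_
    simp
  have hpos : ∀ᶠ s in nhds (0 : ℝ), 0 < r s :=
    (hrd 0).continuousAt.eventually (lt_mem_nhds (by rwa [hr0]))
  have hre : ∀ {φ : ℝ → ℂ} {φ' : ℂ} {s : ℝ}, HasDerivAt φ φ' s →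
      HasDerivAt (fun s => (φ s).re) φ'.re s := fun h =>
    Complex.reCLM.hasFDerivAt.comp_hasDerivAt _ h
  have hlin : HasDerivAt (fun s : ℝ => ((2 * z i + 2 * s : ℝ) : ℂ)) 2 0 := by
    have := (((hasDerivAt_id (0 : ℝ)).const_mul 2).const_add (2 * z i)).ofReal_comp
    simpa using this
  refine d2_eq_of_hasDerivAt (contDiffAt_kelvinPower l (j + 2) a hz)
    (g := fun s => (((((j + 1 : ℕ) : ℂ) + 1) * (L + s * l i) ^ (j + 1) * l i) * ((r s ^ (-a) : ℝ) : ℂ)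
      + (L + s * l i) ^ (j + 2) * (((2 * z i + 2 * s : ℝ) : ℂ) * ((-a : ℝ) : ℂ) *
        ((r s ^ (-a - 1) : ℝ) : ℂ))).re) ?_ ?_
  · filter_upwards [hpos] with s hs
    have h := hre ((hM (j + 1) s).mul (hrp (-a) s hs))
    simp only [kelvinPower, hLs, hρs]
    refine h.congr_deriv ?_
    push_cast
    rfl
  · have h0 : 0 < r 0 := by rwa [hr0]
    have h := hre (((((hM j 0).const_mul (((j + 1 : ℕ) : ℂ) + 1)).mul_const (l i)).mul
      (hrp (-a) 0 h0)).add ((hM (j + 1) 0).mul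
        ((hlin.mul_const ((-a : ℝ) : ℂ)).mul (hrp (-a - 1) 0 h0))))
    refine (h.congr_of_eventuallyEq (Filter.Eventually.of_forall fun s => ?_)).congr_deriv ?_
    · simp [mul_assoc]
    · have e1 : (‖z‖ ^ 2) ^ (-a - 1) = (‖z‖ ^ 2) ^ (-a - 2) * ‖z‖ ^ 2 := by
        rw [← Real.rpow_add_one hρ0.ne']; congr 1; ring
      have e2 : (‖z‖ ^ 2) ^ (-a) = (‖z‖ ^ 2) ^ (-a - 2) * ‖z‖ ^ 4 := by
        rw [show -a = (-a - 1) + 1 by ring, Real.rpow_add_one hρ0.ne', e1]; ring_nf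
      congr 1
      simp only [Pi.mul_apply]
      rw [hr0, show -a - 1 - 1 = -a - 2 by ring, e1, e2]
      push_cast
      ring

lemma harmonicOnE_kelvinPower {N : ℕ} {l : Fin N → ℂ} (hl : ∑ i, l i ^ 2 = 0) (j : ℕ) {a : ℝ}
    (ha : a = N / 2 + 1 + j) : HarmonicOnE (kelvinPower l (j + 2) a) {0}ᶜ := by
  refine ⟨fun z hz => (contDiffAt_kelvinPower l (j + 2) a hz).contDiffWithinAt, fun z hz => ?_⟩
  simp only [d2_kelvinPower l j a hz]
  rw [← Complex.re_sum, ← Finset.mul_sum]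
  have hρ : ∑ i, (z i : ℂ) ^ 2 = (‖z‖ : ℂ) ^ 2 := by
    have := EuclideanSpace.real_norm_sq_eq z
    exact_mod_cast this.symm
  set L : ℂ := ∑ i, l i * z i with hL
  have hs : ∑ i, (((j : ℂ) + 2) * (j + 1) * l i ^ 2 * (‖z‖ : ℂ) ^ 4
          - 4 * a * (j + 2) * L * (l i * z i) * (‖z‖ : ℂ) ^ 2
          - 2 * a * L ^ 2 * (‖z‖ : ℂ) ^ 2
          + 4 * a * (a + 1) * L ^ 2 * (z i : ℂ) ^ 2) = 0 := by
    simp only [Finset.sum_add_distrib, Finset.sum_sub_distrib, ← Finset.mul_sum, ← Finset.sum_mul,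
      hl, hρ, ← hL, Finset.sum_const, Finset.card_univ, Fintype.card_fin, nsmul_eq_mul]
    rw [ha]
    push_cast
    ring
  rw [hs]
  simp

lemma HarmonicOnE.comp_sub {N : ℕ} {f : Euc N → ℝ} {U V : Set (Euc N)} (hf : HarmonicOnE f U)
    (c : Euc N) (hV : ∀ z ∈ V, z - c ∈ U) : HarmonicOnE (fun z => f (z - c)) V := by
  refine ⟨hf.1.comp (by fun_prop) hV, fun z hz => ?_⟩
  simpa only [d2, iteratedFDeriv_comp_sub] using hf.2 _ (hV z hz)

/-- Coefficients of the isotropic linear form `z ↦ t + i x₀`, where `z = (x, t)`. -/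
def isotropicCoeff {n : ℕ} (i₀ : Fin n) : Fin (n + 1) → ℂ :=
  Fin.snoc (α := fun _ => ℂ) (fun i => if i = i₀ then Complex.I else 0) 1

lemma sum_isotropicCoeff_sq {n : ℕ} (i₀ : Fin n) : ∑ i, isotropicCoeff i₀ i ^ 2 = 0 := by
  rw [Fin.sum_univ_castSucc]
  simp [isotropicCoeff, ite_pow]

lemma sum_isotropicCoeff_mul {n : ℕ} (i₀ : Fin n) (z : Euc (n + 1)) :
    ∑ i, isotropicCoeff i₀ i * z i = tp z + z i₀.castSucc * Complex.I := by
  rw [Fin.sum_univ_castSucc]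
  simp [isotropicCoeff, tp, ite_mul]
  ring

lemma norm_sq_eq_sum_add {n : ℕ} (z : Euc (n + 1)) :
    ‖z‖ ^ 2 = ∑ i : Fin n, z i.castSucc ^ 2 + tp z ^ 2 := by
  rw [EuclideanSpace.real_norm_sq_eq, Fin.sum_univ_castSucc]
  rfl

lemma norm_pt_sq {n : ℕ} (x : Euc n) (t : ℝ) : ‖pt x t‖ ^ 2 = ‖x‖ ^ 2 + t ^ 2 := by
  rw [norm_sq_eq_sum_add, EuclideanSpace.real_norm_sq_eq]
  simp

lemma abs_kelvinPower_le {n : ℕ} (i₀ : Fin n) (k : ℕ) (a : ℝ) {z : Euc (n + 1)} (hz : z ≠ 0) :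
    |kelvinPower (isotropicCoeff i₀) k a z| ≤ (‖z‖ ^ 2) ^ (k / 2 - a) := by
  have hz0 : 0 < ‖z‖ ^ 2 := by positivity
  have hL : ‖∑ i, isotropicCoeff i₀ i * z i‖ ≤ ‖z‖ := by
    rw [sum_isotropicCoeff_mul]
    refine le_of_sq_le_sq ?_ (norm_nonneg _)
    rw [Complex.sq_norm, Complex.normSq_add_mul_I, norm_sq_eq_sum_add, add_comm]
    gcongr
    exact Finset.single_le_sum (f := fun i : Fin n => z i.castSucc ^ 2)
      (fun i _ => sq_nonneg _) (Finset.mem_univ i₀)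
  refine (Complex.abs_re_le_norm _).trans ?_
  rw [norm_mul, norm_pow, Complex.norm_real, Real.norm_of_nonneg (by positivity)]
  calc _ ≤ ‖z‖ ^ k * (‖z‖ ^ 2) ^ (-a) := by gcongr
    _ = _ := by
      rw [sub_eq_add_neg, Real.rpow_add hz0]
      congr 1
      rw [← Real.rpow_natCast, ← Real.rpow_natCast, ← Real.rpow_mul (norm_nonneg z)]
      congr 1
      push_cast; ring

/-- Small angles stay in a half plane under the `k`-th power. -/
lemma exists_pos_half_le_re_pow (k : ℕ) :
    ∃ δ : ℝ, 0 < δ ∧ ∀ t x : ℝ, 0 < t → |x| ≤ δ * t →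
      t ^ k / 2 ≤ ((t + x * Complex.I : ℂ) ^ k).re := by
  have hc : Continuous fun ε : ℝ => ((1 + ε * Complex.I : ℂ) ^ k).re := by fun_prop
  have h1 : ∀ᶠ ε : ℝ in nhds 0, (2⁻¹ : ℝ) < ((1 + ε * Complex.I : ℂ) ^ k).re :=
    hc.continuousAt.eventually (lt_mem_nhds (by norm_num))
  obtain ⟨δ, hδ, h⟩ := Metric.eventually_nhds_iff_ball.1 h1
  refine ⟨δ / 2, by positivity, fun t x ht hx => ?_⟩
  have h2 := h (x / t) (by
    rw [mem_ball_zero_iff, Real.norm_eq_abs, abs_div, abs_of_pos ht, div_lt_iff₀ ht]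
    nlinarith)
  have h3 : (t + x * Complex.I : ℂ) ^ k = ((t ^ k : ℝ) : ℂ) * (1 + ((x / t : ℝ) : ℂ) * Complex.I) ^ k := by
    have ht' : (t : ℂ) ≠ 0 := by exact_mod_cast ht.ne'
    push_cast
    rw [← mul_pow]
    congr 1
    field_simp
  rw [h3, Complex.re_ofReal_mul]
  have := mul_le_mul_of_nonneg_left h2.le (pow_nonneg ht.le k)
  linarith

/-- Dilation of a Lebesgue integral. -/
lemma lintegral_eq_mul_lintegral_smul {E : Type*} [NormedAddCommGroup E] [NormedSpace ℝ E]
    [MeasurableSpace E] [BorelSpace E] [FiniteDimensional ℝ E] (ν : Measure E)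
    [ν.IsAddHaarMeasure] {s : ℝ} (hs : 0 < s) (F : E → ℝ≥0∞) :
    ∫⁻ x, F x ∂ν = ENNReal.ofReal (s ^ Module.finrank ℝ E) * ∫⁻ x, F (s • x) ∂ν := by
  have h1 : ∫⁻ x, F (s • x) ∂ν = ∫⁻ x, F x ∂(ν.map (s • ·)) :=
    (lintegral_map_equiv F (Homeomorph.smulOfNeZero s hs.ne').toMeasurableEquiv).symm
  rw [h1, Measure.map_addHaar_smul ν hs.ne', lintegral_smul_measure, smul_eq_mul, ← mul_assoc,
    ← ENNReal.ofReal_mul (by positivity), abs_of_pos (by positivity),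
    mul_inv_cancel₀ (by positivity), ENNReal.ofReal_one, one_mul]

lemma lintegral_norm_sq_add_sq_rpow {n : ℕ} (b : ℝ) {τ : ℝ} (hτ : 0 < τ) :
    ∫⁻ x : Euc n, ENNReal.ofReal ((‖x‖ ^ 2 + τ ^ 2) ^ (-b)) =
      ENNReal.ofReal (τ ^ (n - 2 * b)) *
        ∫⁻ x : Euc n, ENNReal.ofReal ((1 + ‖x‖ ^ 2) ^ (-b)) := by
  rw [lintegral_eq_mul_lintegral_smul volume hτ, finrank_euclideanSpace_fin]
  have h : ∀ x : Euc n, ENNReal.ofReal ((‖τ • x‖ ^ 2 + τ ^ 2) ^ (-b)) =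
      ENNReal.ofReal (τ ^ (-2 * b)) * ENNReal.ofReal ((1 + ‖x‖ ^ 2) ^ (-b)) := by
    intro x
    rw [← ENNReal.ofReal_mul (by positivity), norm_smul, Real.norm_of_nonneg hτ.le,
      show (τ * ‖x‖) ^ 2 + τ ^ 2 = τ ^ 2 * (1 + ‖x‖ ^ 2) by ring,
      Real.mul_rpow (by positivity) (by positivity), ← Real.rpow_natCast, ← Real.rpow_mul hτ.le]
    congr 3
    push_cast; ring
  simp only [h]
  rw [lintegral_const_mul' _ _ ENNReal.ofReal_ne_top, ← mul_assoc,
    ← ENNReal.ofReal_mul (by positivity), ← Real.rpow_natCast, ← Real.rpow_add hτ]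
  congr 3
  ring

lemma lintegral_one_add_norm_sq_rpow_lt_top {n : ℕ} {b : ℝ} (hb : (n : ℝ) < 2 * b) :
    ∫⁻ x : Euc n, ENNReal.ofReal ((1 + ‖x‖ ^ 2) ^ (-b)) < ⊤ := by
  have h := integrable_rpow_neg_one_add_norm_sq (E := Euc n) (μ := volume) (r := 2 * b)
    (by simpa using hb)
  rw [show -(2 * b) / 2 = -b by ring] at h
  exact h.lintegral_lt_top

lemma lintegral_add_rpow_scale (γ β : ℝ) {A s : ℝ} (hA : 0 < A) (hs : 0 < s) :
    ∫⁻ t in Ioi (0 : ℝ), ENNReal.ofReal ((t + A * s) ^ (-γ) * t ^ (β - 1)) =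
      ENNReal.ofReal (s ^ (β - γ)) *
        ∫⁻ t in Ioi (0 : ℝ), ENNReal.ofReal ((t + A) ^ (-γ) * t ^ (β - 1)) := by
  rw [← lintegral_indicator measurableSet_Ioi, ← lintegral_indicator measurableSet_Ioi,
    lintegral_eq_mul_lintegral_smul volume hs, Module.finrank_self, pow_one]
  have h : ∀ t : ℝ, (Ioi (0 : ℝ)).indicator
        (fun t => ENNReal.ofReal ((t + A * s) ^ (-γ) * t ^ (β - 1))) (s • t) =
      ENNReal.ofReal (s ^ (β - γ - 1)) * (Ioi (0 : ℝ)).indicator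
        (fun t => ENNReal.ofReal ((t + A) ^ (-γ) * t ^ (β - 1))) t := by
    intro t
    by_cases ht : 0 < t
    · rw [indicator_of_mem (show s • t ∈ Ioi (0 : ℝ) from mul_pos hs ht),
        indicator_of_mem (show t ∈ Ioi (0 : ℝ) from ht), ← ENNReal.ofReal_mul (by positivity),
        smul_eq_mul, show s * t + A * s = s * (t + A) by ring,
        Real.mul_rpow hs.le (by positivity), Real.mul_rpow hs.le ht.le,
        show β - γ - 1 = -γ + (β - 1) by ring, Real.rpow_add hs]
      congr 1; ring
    · rw [indicator_of_notMem (show s • t ∉ Ioi (0 : ℝ) from fun h => ht (pos_of_mul_pos_right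
        (show 0 < s * t from h) hs.le)), indicator_of_notMem (show t ∉ Ioi (0 : ℝ) from ht), mul_zero]
  simp only [h]
  rw [lintegral_const_mul' _ _ ENNReal.ofReal_ne_top, ← mul_assoc, ← ENNReal.ofReal_mul hs.le]
  congr 2
  conv_lhs => rw [← Real.rpow_one s, ← Real.rpow_mul hs.le, one_mul, ← Real.rpow_add hs]
  congr 1; ring

lemma lintegral_add_rpow_mul_rpow_lt_top {γ β A : ℝ} (hβ : 0 < β) (hγ : β < γ) (hA : 0 < A) :
    ∫⁻ t in Ioi (0 : ℝ), ENNReal.ofReal ((t + A) ^ (-γ) * t ^ (β - 1)) < ⊤ := by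
  rw [← Ioc_union_Ioi_eq_Ioi (zero_le_one : (0 : ℝ) ≤ 1),
    lintegral_union measurableSet_Ioi Ioc_disjoint_Ioi_same, ENNReal.add_lt_top]
  constructor
  · have h : IntegrableOn (fun t : ℝ => A ^ (-γ) * t ^ (β - 1)) (Ioc 0 1) :=
      ((intervalIntegrable_iff_integrableOn_Ioc_of_le zero_le_one).1
        (intervalIntegral.intervalIntegrable_rpow' (by linarith))).const_mul _
    refine lt_of_le_of_lt (setLIntegral_mono' measurableSet_Ioc fun t ht => ?_) h.lintegral_lt_top
    refine ENNReal.ofReal_le_ofReal (mul_le_mul_of_nonneg_right ?_ (Real.rpow_nonneg ht.1.le _))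
    exact Real.rpow_le_rpow_of_nonpos hA (by linarith [ht.1]) (by linarith)
  · have h : IntegrableOn (fun t : ℝ => t ^ (β - 1 - γ)) (Ioi 1) :=
      integrableOn_Ioi_rpow_of_lt (by linarith) one_pos
    refine lt_of_le_of_lt (setLIntegral_mono' measurableSet_Ioi fun t ht => ?_) h.lintegral_lt_top
    have ht0 : 0 < t := one_pos.trans ht
    refine ENNReal.ofReal_le_ofReal ?_
    rw [show β - 1 - γ = -γ + (β - 1) by ring, Real.rpow_add ht0]
    refine mul_le_mul_of_nonneg_right ?_ (by positivity)
    exact Real.rpow_le_rpow_of_nonpos ht0 (by linarith) (by linarith)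

lemma pt_sub_pt {n : ℕ} (x y : Euc n) (t s : ℝ) : pt x t - pt y s = pt (x - y) (t - s) := by
  ext i
  refine Fin.lastCases ?_ (fun i => ?_) i <;> simp

lemma isClosed_Qcube {n : ℕ} (y : Euc n) (s : ℝ) : IsClosed (Qcube y s) := by
  refine IsClosed.inter (s₁ := {z : Euc (n + 1) | ∀ i : Fin n, |z i.castSucc - y i| ≤ s / 2})
    ?_ (isClosed_le (continuous_tp.sub continuous_const).abs continuous_const)
  rw [ofPred_forall]
  exact isClosed_iInter fun i => isClosed_le (by fun_prop) continuous_const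

lemma Qcube_subset_upperHS {n : ℕ} (y : Euc n) {s : ℝ} (hs : 0 < s) :
    Qcube y s ⊆ upperHS n := by
  intro z hz
  have := abs_le.1 hz.2
  show 0 < tp z
  linarith

/-- On cubes seen under a small angle from their pole, the kernel is bounded below. -/
lemma le_abs_kelvinPower {n : ℕ} (i₀ : Fin n) (k : ℕ) {a : ℝ} (ha : 0 ≤ a) {δ : ℝ} (hδ : 0 < δ)
    (h : ∀ t x : ℝ, 0 < t → |x| ≤ δ * t → t ^ k / 2 ≤ ((t + x * Complex.I : ℂ) ^ k).re)
    {A : ℝ} (hA : A = 1 / (2 * δ)) (y : Euc n) {s : ℝ} (hs : 0 < s) {z : Euc (n + 1)}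
    (hz : z ∈ Qcube y s) :
    A ^ k / 2 * (n + (A + 2) ^ 2) ^ (-a) * s ^ (k - 2 * a) ≤
      |kelvinPower (isotropicCoeff i₀) k a (z - pt y (-(A * s)))| := by
  have hA0 : 0 < A := by rw [hA]; positivity
  set w := z - pt y (-(A * s)) with hw
  obtain ⟨hz1, hz2⟩ := hz
  have hz2 := abs_le.1 hz2
  have hwi : ∀ i : Fin n, w i.castSucc = z i.castSucc - y i := fun i => by simp [hw]
  have hwt : tp w = tp z + A * s := by
    have : tp z = z (Fin.last n) := rfl
    rw [this]; simp [hw, tp]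
  have hT1 : A * s ≤ tp w := by linarith
  have hT2 : tp w ≤ (A + 2) * s := by linarith
  have hT0 : 0 < tp w := by nlinarith [mul_pos hA0 hs]
  have hρ : ‖w‖ ^ 2 ≤ (n + (A + 2) ^ 2) * s ^ 2 := by
    rw [norm_sq_eq_sum_add, add_mul, ← mul_pow]
    gcongr
    calc ∑ i : Fin n, w i.castSucc ^ 2 ≤ ∑ _i : Fin n, s ^ 2 := by
          refine Finset.sum_le_sum fun i _ => sq_le_sq' ?_ ?_ <;>
          · have := abs_le.1 (hz1 i)
            rw [hwi]
            linarith
      _ = n * s ^ 2 := by simp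
  have hρ0 : 0 < ‖w‖ ^ 2 := by
    rw [norm_sq_eq_sum_add]; positivity
  have hre := h (tp w) (w i₀.castSucc) hT0 (by
    have h1 := hz1 i₀
    have h2 : s / 2 ≤ δ * tp w := by
      calc s / 2 = δ * (A * s) := by rw [hA]; field_simp
        _ ≤ _ := by gcongr
    rw [hwi]; linarith)
  refine le_trans ?_ (le_abs_self _)
  rw [kelvinPower, sum_isotropicCoeff_mul, Complex.re_mul_ofReal]
  calc A ^ k / 2 * (n + (A + 2) ^ 2) ^ (-a) * s ^ (k - 2 * a)
      = (A * s) ^ k / 2 * ((n + (A + 2) ^ 2) * s ^ 2) ^ (-a) := by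
        rw [Real.mul_rpow (by positivity) (by positivity), mul_pow, ← Real.rpow_natCast s 2,
          ← Real.rpow_mul hs.le, sub_eq_add_neg, Real.rpow_add hs, Real.rpow_natCast]
        push_cast
        rw [show (2 : ℝ) * -a = -(2 * a) by ring]
        ring
    _ ≤ tp w ^ k / 2 * (‖w‖ ^ 2) ^ (-a) := by
        refine mul_le_mul (by gcongr) (Real.rpow_le_rpow_of_nonpos hρ0 hρ (by linarith))
          (by positivity) (by positivity)
    _ ≤ _ := mul_le_mul_of_nonneg_right hre (by positivity)

lemma normB_kelvinPower_rpow_le {n : ℕ} (i₀ : Fin n) (k : ℕ) {a p q α : ℝ} (hp : 0 < p)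
    (hq : 0 < q) {A s : ℝ} (hA : 0 < A) (hs : 0 < s) (y : Euc n) :
    normB n (fun z => kelvinPower (isotropicCoeff i₀) k a (z - pt y (-(A * s)))) q p α ^ q ≤
      (∫⁻ x : Euc n, ENNReal.ofReal ((1 + ‖x‖ ^ 2) ^ (-((a - k / 2) * p)))) ^ (q / p) *
      (∫⁻ t in Ioi (0 : ℝ), ENNReal.ofReal
        ((t + A) ^ (-((2 * a - k - n / p) * q)) * t ^ (α * q - 1))) *
      ENNReal.ofReal (s ^ (α * q - (2 * a - k - n / p) * q)) := by
  set I := ∫⁻ x : Euc n, ENNReal.ofReal ((1 + ‖x‖ ^ 2) ^ (-((a - k / 2) * p))) with hI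
  rw [normB_rpow _ hq, mul_assoc, mul_comm (lintegral _ _), ← lintegral_add_rpow_scale _ _ hA hs]
  have hqp : 0 < q / p := by positivity
  have key : ∀ t ∈ Ioi (0 : ℝ), (∫⁻ x : Euc n, ENNReal.ofReal
      (|kelvinPower (isotropicCoeff i₀) k a (pt x t - pt y (-(A * s)))| ^ p)) ^ (q / p) *
        ENNReal.ofReal (t ^ (α * q - 1)) ≤
      ENNReal.ofReal ((t + A * s) ^ (-((2 * a - k - n / p) * q)) * t ^ (α * q - 1)) *
        I ^ (q / p) := by
    intro t ht
    have ht0 : 0 < t := ht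
    have hτ : 0 < t + A * s := by positivity
    have h1 : ∫⁻ x : Euc n, ENNReal.ofReal
        (|kelvinPower (isotropicCoeff i₀) k a (pt x t - pt y (-(A * s)))| ^ p) ≤
        ENNReal.ofReal ((t + A * s) ^ (n - 2 * ((a - k / 2) * p))) * I := by
      rw [← lintegral_norm_sq_add_sq_rpow _ hτ, ← lintegral_sub_right_eq_self
        (fun x : Euc n => ENNReal.ofReal ((‖x‖ ^ 2 + (t + A * s) ^ 2) ^ _)) y]
      refine lintegral_mono fun x => ENNReal.ofReal_le_ofReal ?_
      have hn := norm_pt_sq (x - y) (t + A * s)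
      have hne : pt (x - y) (t + A * s) ≠ 0 := by
        intro h0
        rw [h0, norm_zero] at hn
        nlinarith [sq_nonneg ‖x - y‖, sq_pos_of_pos hτ]
      rw [pt_sub_pt, sub_neg_eq_add]
      refine (Real.rpow_le_rpow (abs_nonneg _) (abs_kelvinPower_le i₀ k a hne) hp.le).trans
        (le_of_eq ?_)
      rw [hn, ← Real.rpow_mul (by positivity)]
      congr 1; ring
    calc _ ≤ (ENNReal.ofReal ((t + A * s) ^ (n - 2 * ((a - k / 2) * p))) * I) ^ (q / p) *
          ENNReal.ofReal (t ^ (α * q - 1)) := by gcongr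
      _ = _ := by
        rw [ENNReal.mul_rpow_of_nonneg _ _ hqp.le, ENNReal.ofReal_rpow_of_pos (by positivity),
          ← Real.rpow_mul hτ.le, mul_right_comm, ← ENNReal.ofReal_mul (by positivity)]
        congr 4
        field_simp
        ring
  refine (setLIntegral_mono' measurableSet_Ioi key).trans (le_of_eq ?_)
  rw [lintegral_mul_const _ (by fun_prop), mul_comm]

/-- Harmonic functions of controlled mixed norm which are large on a given cube. -/
lemma exists_harmonicOnE_le_abs {n : ℕ} (hn : 0 < n) {p q α : ℝ} (hp : 0 < p) (hq : 0 < q)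
    (hα : 0 < α) : ∃ m κ D : ℝ, 0 < κ ∧ 0 < D ∧ ∀ (y : Euc n) (s : ℝ), 0 < s →
      ∃ f : Euc (n + 1) → ℝ, HarmonicOnE f (upperHS n) ∧
        normB n f q p α ^ q ≤ ENNReal.ofReal (D * s ^ (n * q / p + α * q - m * q)) ∧
        ∀ z ∈ Qcube y s, κ * s ^ (-m) ≤ |f z| := by
  obtain ⟨j, hj⟩ := exists_nat_gt (n / p + α)
  obtain ⟨δ, hδ, hre⟩ := exists_pos_half_le_re_pow (j + 2)
  set A : ℝ := 1 / (2 * δ) with hA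
  have hA0 : 0 < A := by positivity
  set a : ℝ := (n + 1 : ℕ) / 2 + 1 + j with ha
  have hm : 2 * a - (j + 2 : ℕ) = n + 1 + j := by rw [ha]; push_cast; ring
  have hlt : n / p + α < 2 * a - (j + 2 : ℕ) := by rw [hm]; linarith [(n.cast_nonneg : (0 : ℝ) ≤ n)]
  set M : ℝ≥0∞ :=
    (∫⁻ x : Euc n, ENNReal.ofReal ((1 + ‖x‖ ^ 2) ^ (-((a - (j + 2 : ℕ) / 2) * p)))) ^ (q / p) *
      ∫⁻ t in Ioi (0 : ℝ), ENNReal.ofReal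
        ((t + A) ^ (-((2 * a - (j + 2 : ℕ) - n / p) * q)) * t ^ (α * q - 1)) with hM
  have hMtop : M < ⊤ := by
    refine ENNReal.mul_lt_top (ENNReal.rpow_lt_top_of_nonneg (by positivity)
      (lintegral_one_add_norm_sq_rpow_lt_top ?_).ne)
      (lintegral_add_rpow_mul_rpow_lt_top (by positivity) ?_ hA0)
    · have h1 : n / p < 2 * a - (j + 2 : ℕ) := by linarith
      rw [div_lt_iff₀ hp] at h1
      linarith
    · exact mul_lt_mul_of_pos_right (by linarith) hq
  refine ⟨n + 1 + j, A ^ (j + 2) / 2 * (n + (A + 2) ^ 2) ^ (-a), M.toReal + 1, by positivity,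
    by positivity, fun y s hs => ⟨fun z => kelvinPower (isotropicCoeff ⟨0, hn⟩) (j + 2) a
      (z - pt y (-(A * s))), ?_, ?_, fun z hz => ?_⟩⟩
  · refine (harmonicOnE_kelvinPower (sum_isotropicCoeff_sq _) j ha).comp_sub _ fun z hz h0 => ?_
    have hz' : 0 < tp z := hz
    rw [mem_singleton_iff, sub_eq_zero] at h0
    rw [h0, tp_pt] at hz'
    nlinarith [mul_pos hA0 hs]
  · refine (normB_kelvinPower_rpow_le ⟨0, hn⟩ (j + 2) hp hq hA0 hs y).trans ?_
    rw [← hM, ENNReal.ofReal_mul (by positivity)]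
    refine mul_le_mul' ?_ (le_of_eq ?_)
    · rw [← ENNReal.ofReal_toReal hMtop.ne]
      exact ENNReal.ofReal_le_ofReal (by simp)
    · rw [hm]
      congr 2
      ring
  · have h := le_abs_kelvinPower ⟨0, hn⟩ (j + 2) (a := a) (by positivity) hδ hre hA y hs hz
    rw [← hm, neg_sub]
    exact h

lemma carleson_of_embedding {n : ℕ} (hn : 0 < n) {p q α : ℝ} (hp : 0 < p) (hq : 0 < q)
    (hα : 0 < α) {μ : Measure (Euc (n + 1))} {C' : ℝ} (hC' : 0 < C')
    (h : ∀ f : Euc (n + 1) → ℝ, HarmonicOnE f (upperHS n) → normB n f q p α < ⊤ →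
      ∫⁻ z in upperHS n, ENNReal.ofReal (|f z| ^ q) ∂μ ≤
        ENNReal.ofReal C' * normB n f q p α ^ q) :
    ∃ C : ℝ, 0 < C ∧ ∀ (y : Euc n) (r : ℝ), 0 < r →
      μ (Qcube y r) ≤ ENNReal.ofReal (C * r ^ ((n : ℝ) * q / p + α * q)) := by
  obtain ⟨m, κ, D, hκ, hD, H⟩ := exists_harmonicOnE_le_abs hn hp hq hα
  refine ⟨C' * D / κ ^ q, by positivity, fun y r hr => ?_⟩
  obtain ⟨f, hf, hfn, hfQ⟩ := H y r hr
  have hfin : normB n f q p α < ⊤ := by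
    by_contra htop
    rw [not_lt_top_iff.1 htop, ENNReal.top_rpow_of_pos hq] at hfn
    exact absurd hfn (by simp)
  have h1 : ENNReal.ofReal ((κ * r ^ (-m)) ^ q) * μ (Qcube y r) ≤
      ENNReal.ofReal (C' * (D * r ^ (n * q / p + α * q - m * q))) := by
    rw [ENNReal.ofReal_mul hC'.le, ← setLIntegral_const]
    calc _ ≤ ∫⁻ z in Qcube y r, ENNReal.ofReal (|f z| ^ q) ∂μ :=
          setLIntegral_mono' (isClosed_Qcube y r).measurableSet fun z hz =>
            ENNReal.ofReal_le_ofReal (Real.rpow_le_rpow (by positivity) (hfQ z hz) hq.le)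
      _ ≤ ∫⁻ z in upperHS n, ENNReal.ofReal (|f z| ^ q) ∂μ :=
          lintegral_mono_set (Qcube_subset_upperHS y hr)
      _ ≤ _ := (h f hf hfin).trans (mul_le_mul_right hfn _)
  have hpos : 0 < (κ * r ^ (-m)) ^ q := by positivity
  rw [mul_comm, ← ENNReal.le_div_iff_mul_le (Or.inl (by simpa using hpos))
    (Or.inl ENNReal.ofReal_ne_top), ← ENNReal.ofReal_div_of_pos hpos] at h1
  refine h1.trans (le_of_eq ?_)
  congr 1
  rw [Real.mul_rpow hκ.le (by positivity), ← Real.rpow_mul hr.le,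
    Real.rpow_sub hr, neg_mul, Real.rpow_neg hr.le]
  field_simp

/-- Carleson measures for the mixed-norm space B^{q,p}_α. -/
theorem stmt3 (n : ℕ) (hn : 2 ≤ n) (p q α : ℝ) (hp : 0 < p) (hpq : p ≤ q)
    (hα : 0 < α) (μ : Measure (Euc (n + 1))) :
    (∃ C : ℝ, 0 < C ∧ ∀ (y : Euc n) (r : ℝ), 0 < r →
        μ (Qcube y r) ≤ ENNReal.ofReal (C * r ^ ((n : ℝ) * q / p + α * q))) ↔
    (∃ C' : ℝ, 0 < C' ∧ ∀ f : Euc (n + 1) → ℝ,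
        HarmonicOnE f (upperHS n) → normB n f q p α < ⊤ →
        (∫⁻ z in upperHS n, ENNReal.ofReal (|f z| ^ q) ∂μ) ≤
          ENNReal.ofReal C' * (normB n f q p α) ^ q) := by
  have hq : 0 < q := hp.trans_le hpq
  constructor
  · rintro ⟨C, hC, h⟩
    obtain ⟨C', hC', h'⟩ := embedding_of_carleson hp hpq α hC h
    exact ⟨C', hC', fun f hf _ => h' f hf⟩
  · rintro ⟨C', hC', h⟩
    exact carleson_of_embedding (by omega) hp hq hα hC' h

end
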